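/- For every constant γ > 0 there exist constants C > 1 and c > 0 such that the following holds for Algorithm SR (built on Algorithm SSR). Let X and Y be independent (n, 2k)-sources, and assume ε₂ ≤ 2^{−γℓ}, k ≥ 2(bh+2)(h²+12)ℓ, k ≥ (h+1)ℓ, and ℓ ≥ C·h·log₂ n. Let Z = Z¹∘⋯∘Z^N = SR(X, Y). Then with probability at least 1 − 2^{−cℓ} over y ← Y, there exists a subset T ⊆ [N] with |T| ≥ (2/3)N such that for every S ⊆ T with |S| = h, the conditional distribution of (Z^i)_{i∈S} given Y = y satisfies |(Z^i)_{i∈S} − U_{hℓ}| ≤ 2^{−cℓ}. -/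

import Mathlib

open Finset

abbrev BitStr (n : ℕ) := Fin n → Bool

/-- `p` is a probability distribution on the finite type `α`. -/
def IsProb {α : Type*} [Fintype α] (p : α → ℝ) : Prop :=
  (∀ a, 0 ≤ p a) ∧ ∑ a, p a = 1

/-- Statistical distance: `max_{T ⊆ α} |p(T) − q(T)|`. -/
noncomputable def statDist {α : Type*} [Fintype α] (p q : α → ℝ) : ℝ :=
  ⨆ T : Finset α, |∑ a ∈ T, p a - ∑ a ∈ T, q a|

/-- `H_∞(p) ≥ k`, i.e. every point has probability at most `2^(-k)`. -/
def IsKSource {α : Type*} [Fintype α] (p : α → ℝ) (k : ℝ) : Prop :=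
  ∀ a, p a ≤ (2 : ℝ) ^ (-k)

/-- The uniform distribution on a finite type. -/
noncomputable def unif (α : Type*) [Fintype α] : α → ℝ := fun _ => (Fintype.card α : ℝ)⁻¹


/-- `Ext` is a `(k, ε)` seeded extractor. -/
def IsSeededExtractor {n d m : ℕ} (Ext : BitStr n → BitStr d → BitStr m)
    (k ε : ℝ) : Prop :=
  ∀ p : BitStr n → ℝ, IsProb p → IsKSource p k →
    statDist
      (fun v : BitStr m =>
        ∑ x : BitStr n, ∑ r : BitStr d,
          if Ext x r = v then p x * unif (BitStr d) r else 0)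
      (unif (BitStr m)) ≤ ε

/-- `Ext` is a strong `(k, ε)` seeded extractor. -/
def IsStrongSeededExtractor {n d m : ℕ} (Ext : BitStr n → BitStr d → BitStr m)
    (k ε : ℝ) : Prop :=
  ∀ p : BitStr n → ℝ, IsProb p → IsKSource p k →
    statDist
      (fun z : BitStr m × BitStr d =>
        (∑ x : BitStr n, if Ext x z.2 = z.1 then p x else 0) * unif (BitStr d) z.2)
      (fun z => unif (BitStr m) z.1 * unif (BitStr d) z.2) ≤ ε

open Classical in
/-- The probability that a sample from `p` satisfies `P`. -/
noncomputable def probOf {α : Type*} [Fintype α] (p : α → ℝ) (P : α → Prop) : ℝ :=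
  ∑ a, if P a then p a else 0

/-- The first `m` bits of a bit string (padding with `false` if needed). -/
def truncate {r : ℕ} (m : ℕ) (y : BitStr r) : BitStr m :=
  fun i => if h : (i : ℕ) < r then y ⟨i, h⟩ else false

/-- The `d`-bit binary expression of `v`. -/
def natToBits (d : ℕ) (v : ℕ) : BitStr d := fun i => v.testBit (i : ℕ)

/-- Alternating extraction: `laS … j` is `S_{j+1}`. -/
def laS {n nq ℓ : ℕ} (Extq : BitStr nq → BitStr ℓ → BitStr ℓ)
    (Extw : BitStr n → BitStr ℓ → BitStr ℓ)
    (x : BitStr n) (q : BitStr nq) (s₁ : BitStr ℓ) : ℕ → BitStr ℓ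
  | 0 => s₁
  | j + 1 => Extq q (Extw x (laS Extq Extw x q s₁ j))

/-- `laR … j` is `R_{j+1}`; the look-ahead extractor is `(laR … 0, …, laR … (t−1))`. -/
def laR {n nq ℓ : ℕ} (Extq : BitStr nq → BitStr ℓ → BitStr ℓ)
    (Extw : BitStr n → BitStr ℓ → BitStr ℓ)
    (x : BitStr n) (q : BitStr nq) (s₁ : BitStr ℓ) (j : ℕ) : BitStr ℓ :=
  Extw x (laS Extq Extw x q s₁ j)

/-- The value of block `j` (`0`-indexed, blocks of `l` bits from the most significant
side, last block padded with `0`s) of the `d`-bit binary expression of `v`. -/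
def blockVal (d l b : ℕ) (v : ℕ) (j : ℕ) : ℕ :=
  v * 2 ^ (b * l - d) / 2 ^ ((b - 1 - j) * l) % 2 ^ l

/-- Algorithm `SSR(X, Y)` from \cite{Li13b}. -/
def SSR {n rl ℓ M N : ℕ} (d l b : ℕ)
    (Extq : BitStr M → BitStr ℓ → BitStr ℓ) (Extw : BitStr n → BitStr ℓ → BitStr ℓ)
    (Ext : BitStr rl → BitStr ℓ → BitStr M)
    (x : BitStr n) (Y : Fin N → BitStr rl) : Fin N → BitStr ℓ :=
  fun i =>
    let Yj : ℕ → BitStr M := fun j =>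
      Nat.rec (truncate M (Y i))
        (fun j' prev =>
          Ext (Y i) (laR Extq Extw x prev (truncate ℓ prev) (blockVal d l b (i : ℕ) j')))
        j
    laR Extq Extw x (Yj (b - 1)) (truncate ℓ (Yj (b - 1))) (blockVal d l b (i : ℕ) (b - 1))

/-- Algorithm `SR(X, Y)`: for each `i ∈ [2^d]` compute `W_i = Ext₂(X, Ext₁(Y, r_i))`
and `Ȳ^i = Ext₃(Y, W_i)`, then output `SSR(X, Ȳ)`. -/
def SR {n rl ℓ M d : ℕ} (l b : ℕ)
    (Ext₁ : BitStr n → BitStr d → BitStr ℓ) (Ext₂ : BitStr n → BitStr ℓ → BitStr ℓ)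
    (Ext₃ : BitStr n → BitStr ℓ → BitStr rl)
    (Extq : BitStr M → BitStr ℓ → BitStr ℓ) (Extw : BitStr n → BitStr ℓ → BitStr ℓ)
    (Ext : BitStr rl → BitStr ℓ → BitStr M)
    (x y : BitStr n) : Fin (2 ^ d) → BitStr ℓ :=
  SSR d l b Extq Extw Ext x
    (fun i => Ext₃ y (Ext₂ x (Ext₁ y (natToBits d (i : ℕ)))))


set_option linter.unusedSectionVars false

section MeasureBasics
open Classical

/-- Total mass of a (sub)measure. -/
noncomputable def mass {X : Type*} [Fintype X] (a : X → ℝ) : ℝ := ∑ x, a x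

/-- Mass of the fibre of `f` over `v`. -/
noncomputable def law {X V : Type*} [Fintype X] (a : X → ℝ) (f : X → V) (v : V) : ℝ :=
  ∑ x, if f x = v then a x else 0

/-- Restriction of a measure to a predicate. -/
noncomputable def restr {X : Type*} (a : X → ℝ) (P : X → Prop) : X → ℝ :=
  fun x => if P x then a x else 0

/-- Excess of the law of `f` over the uniform law. -/
noncomputable def exc {X V : Type*} [Fintype X] [Fintype V] (a : X → ℝ) (f : X → V) : ℝ :=
  ∑ v, max (law a f v - mass a / Fintype.card V) 0

/-- Keep only the points whose `f`-value is not too heavy. -/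
noncomputable def lightR {X V : Type*} [Fintype X] [Fintype V] (a : X → ℝ) (f : X → V) : X → ℝ :=
  restr a (fun x => law a f (f x) ≤ 2 * mass a / Fintype.card V)

variable {X Y V W O U : Type*} [Fintype X] [Fintype Y] [Fintype V] [Fintype W] [Fintype O]
  [Fintype U]

theorem restr_nonneg {a : X → ℝ} (ha : ∀ x, 0 ≤ a x) (P : X → Prop) (x : X) :
    0 ≤ restr a P x := by
  unfold restr; split_ifs <;> simp [ha]

theorem restr_le {a : X → ℝ} (ha : ∀ x, 0 ≤ a x) (P : X → Prop) (x : X) :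
    restr a P x ≤ a x := by
  unfold restr; split_ifs <;> simp [ha]

theorem restr_ne {a : X → ℝ} {P : X → Prop} {x : X} (h : restr a P x ≠ 0) :
    P x ∧ a x ≠ 0 := by
  unfold restr at h; split_ifs at h with hp
  · exact ⟨hp, h⟩
  · exact absurd rfl h

theorem mass_nonneg {a : X → ℝ} (ha : ∀ x, 0 ≤ a x) : 0 ≤ mass a :=
  Finset.sum_nonneg fun x _ => ha x

theorem mass_mono {a b : X → ℝ} (h : ∀ x, a x ≤ b x) : mass a ≤ mass b :=
  Finset.sum_le_sum fun x _ => h x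

theorem law_nonneg {a : X → ℝ} (ha : ∀ x, 0 ≤ a x) (f : X → V) (v : V) : 0 ≤ law a f v :=
  Finset.sum_nonneg fun x _ => by split_ifs <;> simp [ha]

theorem law_mono {a b : X → ℝ} (h : ∀ x, a x ≤ b x) (f : X → V) (v : V) :
    law a f v ≤ law b f v :=
  Finset.sum_le_sum fun x _ => by split_ifs <;> simp [h]

/-- Integration of a function of `f` against the law. -/
theorem sum_law_mul (a : X → ℝ) (f : X → V) (φ : V → ℝ) :
    ∑ v, law a f v * φ v = ∑ x, a x * φ (f x) := by
  unfold law
  simp_rw [Finset.sum_mul]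
  rw [Finset.sum_comm]
  refine Finset.sum_congr rfl fun x _ => ?_
  simp [ite_mul]

theorem sum_law (a : X → ℝ) (f : X → V) : ∑ v, law a f v = mass a := by
  have := sum_law_mul a f (fun _ => 1)
  simpa [mass] using this

theorem law_eq_mass_restr (a : X → ℝ) (f : X → V) (v : V) :
    law a f v = mass (restr a (fun x => f x = v)) := rfl

theorem sum_mass_restr (a : X → ℝ) (f : X → V) :
    ∑ v, mass (restr a (fun x => f x = v)) = mass a := sum_law a f

theorem law_le_mass {a : X → ℝ} (ha : ∀ x, 0 ≤ a x) (f : X → V) (v : V) :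
    law a f v ≤ mass a :=
  mass_mono (restr_le ha _)

theorem sum_restr (a : X → ℝ) (f : X → V) (x : X) :
    ∑ v, restr a (fun x => f x = v) x = a x := by
  unfold restr; simp

theorem law_split (a : X → ℝ) (f : X → V) (ρ : X → W) (v : V) :
    law a f v = ∑ c, law (restr a (fun x => ρ x = c)) f v := by
  unfold law
  rw [Finset.sum_comm]
  refine Finset.sum_congr rfl fun x _ => ?_
  by_cases h : f x = v
  · simp only [h, if_true]; exact (sum_restr a ρ x).symm
  · simp [h]

theorem law_law (a : X → ℝ) (g : X → U) (f : U → V) (v : V) :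
    law (law a g) f v = law a (fun x => f (g x)) v := by
  have := sum_law_mul a g (fun u => if f u = v then 1 else 0)
  simpa [law] using this

theorem law_congr {a : X → ℝ} {f f' : X → V} (h : ∀ x, a x ≠ 0 → f x = f' x) (v : V) :
    law a f v = law a f' v := by
  unfold law
  refine Finset.sum_congr rfl fun x _ => ?_
  by_cases hx : a x = 0
  · simp [hx]
  · simp [h x hx]

theorem law_const (a : X → ℝ) (w v : V) :
    law a (fun _ => w) v = if v = w then mass a else 0 := by
  unfold law mass
  by_cases h : v = w
  · simp [h]
  · simp [h, Ne.symm h]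

theorem law_const_prod (a : X → ℝ) (f : X → V) (w v : O) (z : V) :
    law a (fun x => (w, f x)) (v, z) = if v = w then law a f z else 0 := by
  unfold law
  by_cases h : v = w
  · simp [h]
  · simp [h, Ne.symm h]

theorem mass_law (a : X → ℝ) (g : X → U) : mass (law a g) = mass a := sum_law a g

theorem exc_law (a : X → ℝ) (g : X → U) (f : U → V) :
    exc (law a g) f = exc a (fun x => f (g x)) := by
  unfold exc; simp_rw [law_law, mass_law]

theorem exc_nonneg (a : X → ℝ) (f : X → V) : 0 ≤ exc a f :=
  Finset.sum_nonneg fun _ _ => le_max_right _ _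

theorem lightR_nonneg {a : X → ℝ} (ha : ∀ x, 0 ≤ a x) (f : X → V) (x : X) :
    0 ≤ lightR a f x := restr_nonneg ha _ x

theorem lightR_le {a : X → ℝ} (ha : ∀ x, 0 ≤ a x) (f : X → V) (x : X) :
    lightR a f x ≤ a x := restr_le ha _ x

theorem law_lightR {a : X → ℝ} (ha : ∀ x, 0 ≤ a x) (f : X → V) (v : V) :
    law (lightR a f) f v ≤ 2 * mass a / Fintype.card V := by
  by_cases h : law a f v ≤ 2 * mass a / Fintype.card V
  · exact (law_mono (lightR_le ha f) f v).trans h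
  · have : law (lightR a f) f v = 0 := by
      unfold law
      refine Finset.sum_eq_zero fun x _ => ?_
      split_ifs with hx
      · subst hx
        unfold lightR restr
        rw [if_neg h]
      · rfl
    rw [this]
    have := mass_nonneg ha
    positivity

/-- The removed mass is at most twice the excess. -/
theorem mass_sub_lightR {a : X → ℝ} (_ha : ∀ x, 0 ≤ a x) (f : X → V) :
    mass (fun x => a x - lightR a f x) ≤ 2 * exc a f := by
  have h1 : mass (fun x => a x - lightR a f x)
      = ∑ x, a x * (if law a f (f x) ≤ 2 * mass a / Fintype.card V then 0 else 1) := by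
    rw [mass]
    refine Finset.sum_congr rfl fun x _ => ?_
    unfold lightR restr
    split_ifs with h <;> simp
  rw [h1, ← sum_law_mul a f (fun v => if law a f v ≤ 2 * mass a / Fintype.card V then 0 else 1)]
  unfold exc
  rw [Finset.mul_sum]
  refine Finset.sum_le_sum fun v _ => ?_
  split_ifs with h
  · have := le_max_right (law a f v - mass a / Fintype.card V) 0
    simp [this]
  · have h2 := le_max_left (law a f v - mass a / Fintype.card V) 0
    push Not at h
    have : 2 * mass a / Fintype.card V = 2 * (mass a / Fintype.card V) := by ring
    linarith

/-- The defect functional: how far `Z` is from uniform given `O`, averaged over `y`. -/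
noncomputable def defect (a : X → ℝ) (b : Y → ℝ) (o : X → Y → O) (z : X → Y → V) : ℝ :=
  ∑ y, b y * ∑ u, ∑ w, max (law a (fun x => (o x y, z x y)) (u, w)
    - law a (fun x => o x y) u / Fintype.card V) 0

theorem posPart_add_le' (s t : ℝ) : max (s + t) 0 ≤ max s 0 + max t 0 := by
  apply max_le
  · exact add_le_add (le_max_left s 0) (le_max_left t 0)
  · exact add_nonneg (le_max_right s 0) (le_max_right t 0)

theorem posPart_sum_le' {ι : Type*} (s : Finset ι) (f : ι → ℝ) :
    max (∑ i ∈ s, f i) 0 ≤ ∑ i ∈ s, max (f i) 0 := by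
  induction s using Finset.induction_on with
  | empty => simp
  | insert i s hi ih =>
    rw [Finset.sum_insert hi, Finset.sum_insert hi]
    exact (posPart_add_le' _ _).trans (by linarith)

theorem inner_le_mass {a : X → ℝ} (ha : ∀ x, 0 ≤ a x) (o : X → O) (z : X → V) :
    ∑ u, ∑ w, max (law a (fun x => (o x, z x)) (u, w)
      - law a o u / Fintype.card V) 0 ≤ mass a := by
  have : ∑ u, ∑ w, max (law a (fun x => (o x, z x)) (u, w)
      - law a o u / Fintype.card V) 0 ≤ ∑ u, ∑ w, law a (fun x => (o x, z x)) (u, w) := by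
    refine Finset.sum_le_sum fun u _ => Finset.sum_le_sum fun w _ => max_le ?_ (law_nonneg ha _ _)
    have := law_nonneg ha o u
    have : 0 ≤ law a o u / Fintype.card V := by positivity
    linarith
  refine this.trans (le_of_eq ?_)
  rw [← Fintype.sum_prod_type' (f := fun u w => law a (fun x => (o x, z x)) (u, w))]
  exact sum_law a (fun x => (o x, z x))

theorem defect_le_mass {a : X → ℝ} {b : Y → ℝ} (ha : ∀ x, 0 ≤ a x) (hb : ∀ y, 0 ≤ b y)
    (o : X → Y → O) (z : X → Y → V) : defect a b o z ≤ mass a * mass b := by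
  unfold defect
  calc _ ≤ ∑ y, b y * mass a := Finset.sum_le_sum fun y _ =>
        mul_le_mul_of_nonneg_left (inner_le_mass ha _ _) (hb y)
    _ = _ := by rw [← Finset.sum_mul, mul_comm]; rfl

theorem defect_split_X {b : Y → ℝ} (hb : ∀ y, 0 ≤ b y) {C : Type*} [Fintype C]
    (a : X → ℝ) (o : X → Y → O) (z : X → Y → V) (ρ : X → C) :
    defect a b o z ≤ ∑ c, defect (restr a (fun x => ρ x = c)) b o z := by
  unfold defect
  conv_rhs => rw [Finset.sum_comm]
  refine Finset.sum_le_sum fun y _ => ?_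
  rw [← Finset.mul_sum]
  refine mul_le_mul_of_nonneg_left ?_ (hb y)
  conv_rhs => rw [Finset.sum_comm]
  refine Finset.sum_le_sum fun u _ => ?_
  conv_rhs => rw [Finset.sum_comm]
  refine Finset.sum_le_sum fun w _ => ?_
  rw [law_split a _ ρ, law_split a _ ρ, Finset.sum_div, ← Finset.sum_sub_distrib]
  exact posPart_sum_le' _ _

theorem defect_split_Y {C : Type*} [Fintype C] (a : X → ℝ) (b : Y → ℝ)
    (o : X → Y → O) (z : X → Y → V) (σ : Y → C) :
    defect a b o z = ∑ c, defect a (restr b (fun y => σ y = c)) o z := by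
  unfold defect
  rw [Finset.sum_comm]
  refine Finset.sum_congr rfl fun y _ => ?_
  rw [← Finset.sum_mul, sum_restr]

theorem law_add (a a' : X → ℝ) (f : X → V) (v : V) :
    law (fun x => a x + a' x) f v = law a f v + law a' f v := by
  unfold law
  rw [← Finset.sum_add_distrib]
  refine Finset.sum_congr rfl fun x _ => ?_
  split_ifs <;> simp

theorem defect_add_X {b : Y → ℝ} (hb : ∀ y, 0 ≤ b y)
    (a a' : X → ℝ) (o : X → Y → O) (z : X → Y → V) :
    defect (fun x => a x + a' x) b o z ≤ defect a b o z + defect a' b o z := by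
  unfold defect
  rw [← Finset.sum_add_distrib]
  refine Finset.sum_le_sum fun y _ => ?_
  rw [← mul_add]
  refine mul_le_mul_of_nonneg_left ?_ (hb y)
  rw [← Finset.sum_add_distrib]
  refine Finset.sum_le_sum fun u _ => ?_
  rw [← Finset.sum_add_distrib]
  refine Finset.sum_le_sum fun w _ => ?_
  rw [law_add, law_add]
  refine le_trans (le_of_eq ?_) (posPart_add_le' _ _)
  congr 1; ring

theorem defect_add_Y (a : X → ℝ) (b b' : Y → ℝ) (o : X → Y → O) (z : X → Y → V) :
    defect a (fun y => b y + b' y) o z = defect a b o z + defect a b' o z := by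
  unfold defect
  rw [← Finset.sum_add_distrib]
  refine Finset.sum_congr rfl fun y _ => ?_
  ring

theorem defect_light_Y {a : X → ℝ} {b : Y → ℝ} (ha : ∀ x, 0 ≤ a x) (hb : ∀ y, 0 ≤ b y)
    (o : X → Y → O) (z : X → Y → V) (f : Y → W) :
    defect a b o z ≤ mass a * (2 * exc b f) + defect a (lightR b f) o z := by
  have h := defect_add_Y a (fun y => b y - lightR b f y) (lightR b f) o z
  simp only [sub_add_cancel] at h
  have h2 := defect_le_mass ha (b := fun y => b y - lightR b f y)
    (fun y => sub_nonneg.2 (lightR_le hb f y)) o z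
  have h3 := mul_le_mul_of_nonneg_left (mass_sub_lightR hb f) (mass_nonneg ha)
  change defect a b o z = _ at h
  linarith

theorem defect_light_X {a : X → ℝ} {b : Y → ℝ} (ha : ∀ x, 0 ≤ a x) (hb : ∀ y, 0 ≤ b y)
    (o : X → Y → O) (z : X → Y → V) (f : X → W) :
    defect a b o z ≤ mass b * (2 * exc a f) + defect (lightR a f) b o z := by
  have h := defect_add_X hb (fun y => a y - lightR a f y) (lightR a f) o z
  simp only [sub_add_cancel] at h
  have h2 := defect_le_mass (a := fun y => a y - lightR a f y) 
    (fun y => sub_nonneg.2 (lightR_le ha f y)) hb o z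
  have h3 := mul_le_mul_of_nonneg_right (mass_sub_lightR ha f) (mass_nonneg hb)
  change defect a b o z ≤ _ at h
  linarith

/-- `E` is a strong extractor in excess form. -/
def GoodExt {R : Type*} [Fintype R] (E : U → R → W) (T ε : ℝ) : Prop :=
  ∀ μ : U → ℝ, (∀ u, 0 ≤ μ u) → ∀ κ : ℝ, (∀ u, μ u ≤ κ) →
    ∑ r, exc μ (fun u => E u r) ≤ Fintype.card R * (ε * (mass μ + T * κ))

theorem GoodExt.apply {R : Type*} [Fintype R] {E : U → R → W} {T ε : ℝ} (hE : GoodExt E T ε)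
    {b : Y → ℝ} (hb : ∀ y, 0 ≤ b y) (g : Y → U) {κ : ℝ} (hκ : ∀ u, law b g u ≤ κ) :
    ∑ r, exc b (fun y => E (g y) r) ≤ Fintype.card R * (ε * (mass b + T * κ)) := by
  have := hE (law b g) (law_nonneg hb g) κ hκ
  simpa only [mass_law, exc_law b g (fun u => E u _)] using this

/-- Using a nearly uniform seed. -/
theorem GoodExt.seed {R : Type*} [Fintype R] [Nonempty R] {E : U → R → W} {T ε : ℝ}
    (hE : GoodExt E T ε)
    {b : Y → ℝ} (hb : ∀ y, 0 ≤ b y) (g : Y → U) {κ : ℝ} (hκ : ∀ u, law b g u ≤ κ)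
    {a : X → ℝ} {s : X → R} {A : ℝ} (hA : 0 ≤ A)
    (hs : ∀ r, law a s r ≤ 2 * A / Fintype.card R) :
    ∑ x, a x * exc b (fun y => E (g y) (s x)) ≤ 2 * A * (ε * (mass b + T * κ)) := by
  rw [← sum_law_mul a s (fun r => exc b (fun y => E (g y) r))]
  have hc : (0 : ℝ) < Fintype.card R := by exact_mod_cast Fintype.card_pos
  calc _ ≤ ∑ r, 2 * A / Fintype.card R * exc b (fun y => E (g y) r) :=
        Finset.sum_le_sum fun r _ => mul_le_mul_of_nonneg_right (hs r) (exc_nonneg _ _)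
    _ = 2 * A / Fintype.card R * ∑ r, exc b (fun y => E (g y) r) := by rw [Finset.mul_sum]
    _ ≤ 2 * A / Fintype.card R * (Fintype.card R * (ε * (mass b + T * κ))) :=
        mul_le_mul_of_nonneg_left (hE.apply hb g hκ) (by positivity)
    _ = _ := by field_simp

theorem sum_mass_restr_mul {C : Type*} [Fintype C] (a : X → ℝ) (ρ : X → C) (φ : C → ℝ) :
    ∑ c, mass (restr a (fun x => ρ x = c)) * φ c = ∑ x, a x * φ (ρ x) :=
  sum_law_mul a ρ φ

/-- One extraction step: seeds from `X`, source from `Y`. -/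
theorem step_XY {ι R : Type*} [Fintype ι] [DecidableEq ι] [Fintype R] [Nonempty R] (i₀ : ι) {E : U → R → W} {T ε : ℝ}
    (hE : GoodExt E T ε) {a : X → ℝ} {b : Y → ℝ} (ha : ∀ x, 0 ≤ a x) (hb : ∀ y, 0 ≤ b y)
    (o : X → Y → O) (z : X → Y → V)
    (g : Y → U) {κ : ℝ} (hκ : ∀ u, law b g u ≤ κ)
    {ρ : X → ι → R} {A : ℝ} (hA : 0 ≤ A)
    (hs : ∀ r, law a (fun x => ρ x i₀) r ≤ 2 * A / Fintype.card R) :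
    defect a b o z ≤ 4 * ε * A * (mass b + T * κ) +
      ∑ c, defect (restr a (fun x => ρ x = c)) (lightR b (fun y => E (g y) (c i₀))) o z := by
  calc _ ≤ ∑ c, defect (restr a (fun x => ρ x = c)) b o z := defect_split_X hb a o z ρ
    _ ≤ ∑ c, (mass (restr a (fun x => ρ x = c)) * (2 * exc b (fun y => E (g y) (c i₀))) +
          defect (restr a (fun x => ρ x = c)) (lightR b (fun y => E (g y) (c i₀))) o z) :=
        Finset.sum_le_sum fun c _ => defect_light_Y (restr_nonneg ha _) hb o z _
    _ = _ := Finset.sum_add_distrib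
    _ ≤ _ := by
        gcongr
        rw [sum_mass_restr_mul a ρ (fun c => 2 * exc b (fun y => E (g y) (c i₀)))]
        have := hE.seed hb g hκ (a := a) (s := fun x => ρ x i₀) hA hs
        have h2 : ∑ x, a x * (2 * exc b (fun y => E (g y) (ρ x i₀)))
            = 2 * ∑ x, a x * exc b (fun y => E (g y) (ρ x i₀)) := by
          rw [Finset.mul_sum]; exact Finset.sum_congr rfl fun x _ => by ring
        rw [h2]; linarith

/-- One extraction step: seeds from `Y`, source from `X`. -/
theorem step_YX {ι R : Type*} [Fintype ι] [DecidableEq ι] [Fintype R] [Nonempty R] (i₀ : ι) {E : U → R → W} {T ε : ℝ}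
    (hE : GoodExt E T ε) {a : X → ℝ} {b : Y → ℝ} (ha : ∀ x, 0 ≤ a x) (hb : ∀ y, 0 ≤ b y)
    (o : X → Y → O) (z : X → Y → V)
    (g : X → U) {κ : ℝ} (hκ : ∀ u, law a g u ≤ κ)
    {σ : Y → ι → R} {B : ℝ} (hB : 0 ≤ B)
    (hs : ∀ r, law b (fun y => σ y i₀) r ≤ 2 * B / Fintype.card R) :
    defect a b o z ≤ 4 * ε * B * (mass a + T * κ) +
      ∑ c, defect (lightR a (fun x => E (g x) (c i₀))) (restr b (fun y => σ y = c)) o z := by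
  calc _ = ∑ c, defect a (restr b (fun y => σ y = c)) o z := defect_split_Y a b o z σ
    _ ≤ ∑ c, (mass (restr b (fun x => σ x = c)) * (2 * exc a (fun y => E (g y) (c i₀))) +
          defect (lightR a (fun x => E (g x) (c i₀))) (restr b (fun y => σ y = c)) o z) :=
        Finset.sum_le_sum fun c _ => defect_light_X ha (restr_nonneg hb _) o z _
    _ = _ := Finset.sum_add_distrib
    _ ≤ _ := by
        gcongr
        rw [sum_mass_restr_mul b σ (fun c => 2 * exc a (fun y => E (g y) (c i₀)))]
        have := hE.seed ha g hκ (a := b) (s := fun x => σ x i₀) hB hs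
        have h2 : ∑ x, b x * (2 * exc a (fun y => E (g y) (σ x i₀)))
            = 2 * ∑ x, b x * exc a (fun y => E (g y) (σ x i₀)) := by
          rw [Finset.mul_sum]; exact Finset.sum_congr rfl fun x _ => by ring
        rw [h2]; linarith

/-- The last step: `Z = E (g x) (σ y)` and `O` constant on the support. -/
theorem step_final {R : Type*} [Fintype R] [Nonempty R] [Nonempty V] {E : U → R → V} {T ε : ℝ}
    (hE : GoodExt E T ε) {a : X → ℝ} {b : Y → ℝ} (ha : ∀ x, 0 ≤ a x) (hb : ∀ y, 0 ≤ b y)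
    (o : X → Y → O) (z : X → Y → V)
    (g : X → U) {κ : ℝ} (hκ : ∀ u, law a g u ≤ κ)
    {σ : Y → R} {B : ℝ} (hB : 0 ≤ B)
    (hs : ∀ r, law b σ r ≤ 2 * B / Fintype.card R)
    (hz : ∀ x y, a x ≠ 0 → b y ≠ 0 → z x y = E (g x) (σ y))
    (ho : ∀ x y x' y', a x ≠ 0 → b y ≠ 0 → a x' ≠ 0 → b y' ≠ 0 → o x y = o x' y') :
    defect a b o z ≤ 2 * ε * B * (mass a + T * κ) := by
  have h1 := hE.seed ha g hκ (a := b) (s := σ) hB hs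
  refine le_trans ?_ (h1.trans (le_of_eq (by ring)))
  unfold defect
  refine Finset.sum_le_sum fun y _ => ?_
  by_cases hy : b y = 0
  · simp [hy]
  refine mul_le_mul_of_nonneg_left ?_ (hb y)
  by_cases hx : ∃ x, a x ≠ 0
  · obtain ⟨x₀, hx₀⟩ := hx
    have hl1 : ∀ u w, law a (fun x => (o x y, z x y)) (u, w)
        = if u = o x₀ y then law a (fun x => E (g x) (σ y)) w else 0 := by
      intro u w
      rw [← law_const_prod]
      exact law_congr (fun x hx => by rw [hz x y hx hy, ho x y x₀ y hx hy hx₀ hy]) _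
    have hl2 : ∀ u, law a (fun x => o x y) u
        = if u = o x₀ y then mass a else 0 := by
      intro u
      rw [← law_const]
      exact law_congr (fun x hx => ho x y x₀ y hx hy hx₀ hy) _
    simp_rw [hl1, hl2]
    rw [Finset.sum_eq_single (o x₀ y)]
    · simp [exc]
    · intro u _ hu; simp [hu]
    · simp
  · push Not at hx
    refine le_trans (le_of_eq ?_) (exc_nonneg _ _)
    refine Finset.sum_eq_zero fun u _ => Finset.sum_eq_zero fun w _ => ?_
    have h1 : law a (fun x => (o x y, z x y)) (u, w) = 0 := by unfold law; simp [hx]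
    have h2 : law a (fun x => o x y) u = 0 := by unfold law; simp [hx]
    rw [h1, h2]; simp

theorem defect_congr {a : X → ℝ} {b : Y → ℝ} {o o' : X → Y → O} {z z' : X → Y → V}
    (ho : ∀ x y, a x ≠ 0 → b y ≠ 0 → o x y = o' x y)
    (hz : ∀ x y, a x ≠ 0 → b y ≠ 0 → z x y = z' x y) :
    defect a b o z = defect a b o' z' := by
  unfold defect
  refine Finset.sum_congr rfl fun y _ => ?_
  by_cases hy : b y = 0
  · simp [hy]
  congr 1
  refine Finset.sum_congr rfl fun u _ => Finset.sum_congr rfl fun w _ => ?_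
  rw [law_congr (f' := fun x => (o' x y, z' x y)) (fun x hx => by rw [ho x y hx hy, hz x y hx hy]),
    law_congr (f' := fun x => o' x y) (fun x hx => ho x y hx hy)]

end MeasureBasics


section ExtConv
open Classical

theorem abs_le_statDist {α : Type*} [Fintype α] (p q : α → ℝ) (T : Finset α) :
    |∑ a ∈ T, p a - ∑ a ∈ T, q a| ≤ statDist p q :=
  le_ciSup (f := fun T : Finset α => |∑ a ∈ T, p a - ∑ a ∈ T, q a|)
    (Set.finite_range _).bddAbove T

theorem posPart_le_statDist {α : Type*} [Fintype α] (p q : α → ℝ) :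
    ∑ a, max (p a - q a) 0 ≤ statDist p q := by
  refine le_trans ?_ (abs_le_statDist p q (univ.filter fun a => q a ≤ p a))
  refine le_trans ?_ (le_abs_self _)
  rw [← Finset.sum_sub_distrib, Finset.sum_filter]
  refine Finset.sum_le_sum fun a _ => ?_
  split_ifs with h
  · exact max_le le_rfl (by linarith)
  · exact max_le (by linarith) le_rfl

theorem statDist_le_posPart {α : Type*} [Fintype α] (p q : α → ℝ) (h : ∑ a, p a = ∑ a, q a) :
    statDist p q ≤ ∑ a, max (p a - q a) 0 := by
  have key : ∀ T : Finset α, ∑ a ∈ T, p a - ∑ a ∈ T, q a ≤ ∑ a, max (p a - q a) 0 := by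
    intro T
    rw [← Finset.sum_sub_distrib]
    calc _ ≤ ∑ a ∈ T, max (p a - q a) 0 := Finset.sum_le_sum fun a _ => le_max_left _ _
      _ ≤ _ := Finset.sum_le_sum_of_subset_of_nonneg (Finset.subset_univ _)
          fun _ _ _ => le_max_right _ _
  refine ciSup_le fun T => abs_le.2 ⟨?_, key T⟩
  have h1 := key Tᶜ
  have h2 := Finset.sum_add_sum_compl T p
  have h3 := Finset.sum_add_sum_compl T q
  linarith

theorem card_bitStr (n : ℕ) : (Fintype.card (BitStr n) : ℝ) = 2 ^ n := by
  simp [BitStr]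

theorem law_smul {X V : Type*} [Fintype X] (c : ℝ) (a : X → ℝ) (f : X → V) (v : V) :
    law (fun x => c * a x) f v = c * law a f v := by
  unfold law; rw [Finset.mul_sum]
  exact Finset.sum_congr rfl fun x _ => by split_ifs <;> simp

theorem mass_smul {X : Type*} [Fintype X] (c : ℝ) (a : X → ℝ) :
    mass (fun x => c * a x) = c * mass a := by
  unfold mass; rw [Finset.mul_sum]

theorem exc_smul {X V : Type*} [Fintype X] [Fintype V] {c : ℝ} (hc : 0 ≤ c) (a : X → ℝ)
    (f : X → V) : exc (fun x => c * a x) f = c * exc a f := by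
  unfold exc; rw [Finset.mul_sum]
  refine Finset.sum_congr rfl fun v _ => ?_
  rw [law_smul, mass_smul, mul_max_of_nonneg _ _ hc]
  congr 1 <;> ring

theorem exc_le_mass {X V : Type*} [Fintype X] [Fintype V] {a : X → ℝ} (ha : ∀ x, 0 ≤ a x)
    (f : X → V) : exc a f ≤ mass a := by
  rw [← sum_law a f]
  refine Finset.sum_le_sum fun v _ => max_le ?_ (law_nonneg ha _ _)
  have := mass_nonneg ha
  have : 0 ≤ mass a / Fintype.card V := by positivity
  linarith

/-- Strong extractors in excess form, for probability distributions. -/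
theorem strong_exc {n ℓ m : ℕ} {E : BitStr n → BitStr ℓ → BitStr m} {K ε : ℝ}
    (hE : IsStrongSeededExtractor E K ε) {p : BitStr n → ℝ} (hp : IsProb p)
    (hk : IsKSource p K) :
    ∑ r, exc p (fun u => E u r) ≤ 2 ^ ℓ * ε := by
  have h := (posPart_le_statDist _ _).trans (hE p hp hk)
  rw [Fintype.sum_prod_type, Finset.sum_comm] at h
  have h2 : ∑ r, exc p (fun u => E u r) = 2 ^ ℓ * ∑ y : BitStr ℓ, ∑ x : BitStr m,
      max ((∑ x_1, if E x_1 (x, y).2 = (x, y).1 then p x_1 else 0) * unif (BitStr ℓ) (x, y).2 -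
        unif (BitStr m) (x, y).1 * unif (BitStr ℓ) (x, y).2) 0 := by
    rw [Finset.mul_sum]
    refine Finset.sum_congr rfl fun r _ => ?_
    unfold exc
    rw [Finset.mul_sum]
    refine Finset.sum_congr rfl fun v _ => ?_
    rw [mul_max_of_nonneg _ _ (by positivity)]
    have hm : mass p = 1 := hp.2
    rw [hm]
    unfold unif law
    rw [card_bitStr, card_bitStr]
    congr 1
    · field_simp
      congr 1
      rw [mul_comm]
      congr!
    · simp
  rw [h2]
  exact mul_le_mul_of_nonneg_left h (by positivity)

theorem goodExt_of_strong {n ℓ m : ℕ} {E : BitStr n → BitStr ℓ → BitStr m} {K : ℕ} {ε₂ ε : ℝ}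
    (hE : IsStrongSeededExtractor E (K : ℝ) ε₂) (hε : ε₂ ≤ ε) (h1 : 1 ≤ ε * 2 ^ ℓ) :
    GoodExt E (2 ^ (K + ℓ)) ε := by
  intro μ hμ κ hκ
  have hm := mass_nonneg hμ
  have hκ0 : 0 ≤ κ := (hμ (fun _ => false)).trans (hκ _)
  have hε0 : 0 ≤ ε := by
    by_contra h
    push Not at h
    have : ε * 2 ^ ℓ < 0 := mul_neg_of_neg_of_pos h (by positivity)
    linarith
  rw [card_bitStr]
  by_cases h : 2 ^ K * κ ≤ mass μ ∧ 0 < mass μ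
  · obtain ⟨h, hpos⟩ := h
    have := strong_exc hE (p := fun u => (mass μ)⁻¹ * μ u)
      ⟨fun u => mul_nonneg (by positivity) (hμ u), by
        have := mass_smul (mass μ)⁻¹ μ
        unfold mass at this ⊢
        rw [this]; exact inv_mul_cancel₀ hpos.ne'⟩
      (fun u => by
        rw [Real.rpow_neg (by norm_num), Real.rpow_natCast]
        rw [inv_mul_le_iff₀ hpos, ← div_eq_mul_inv, le_div_iff₀ (by positivity)]
        calc μ u * 2 ^ K ≤ κ * 2 ^ K := by gcongr; exact hκ u
          _ ≤ _ := by linarith)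
    simp_rw [exc_smul (inv_nonneg.2 hm)] at this
    rw [← Finset.mul_sum, inv_mul_le_iff₀ hpos] at this
    refine this.trans ?_
    have h3 : 0 ≤ ε * ((2:ℝ) ^ (K + ℓ) * κ) := by positivity
    have h4 : (2:ℝ) ^ ℓ * ε₂ ≤ 2 ^ ℓ * ε := by gcongr
    calc mass μ * (2 ^ ℓ * ε₂) ≤ mass μ * (2 ^ ℓ * ε) := by gcongr
      _ = 2 ^ ℓ * (ε * mass μ) := by ring
      _ ≤ _ := by rw [mul_add ε]; gcongr; linarith
  · have hle : mass μ ≤ 2 ^ K * κ := by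
      by_contra h'
      push Not at h'
      refine h ⟨h'.le, lt_of_le_of_lt (by positivity) h'⟩
    calc ∑ r, exc μ (fun u => E u r) ≤ ∑ r : BitStr ℓ, mass μ :=
          Finset.sum_le_sum fun r _ => exc_le_mass hμ _
      _ = 2 ^ ℓ * mass μ := by rw [Finset.sum_const, nsmul_eq_mul, Finset.card_univ, card_bitStr]
      _ ≤ 2 ^ ℓ * (ε * (mass μ + 2 ^ (K + ℓ) * κ)) := by
          gcongr
          calc mass μ ≤ 1 * (2 ^ K * κ) := by linarith
            _ ≤ (ε * 2 ^ ℓ) * (2 ^ K * κ) := by gcongr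
            _ = ε * (2 ^ (K + ℓ) * κ) := by rw [pow_add]; ring
            _ ≤ _ := by gcongr; linarith

end ExtConv

set_option linter.unusedSectionVars false

section SSRAnalysis
open Classical

theorem card_trunc_fibre {r m : ℕ} (hmr : m ≤ r) (v : BitStr m) :
    (univ.filter fun u : BitStr r => truncate m u = v).card ≤ 2 ^ (r - m) := by
  have hc : Fintype.card (BitStr (r - m)) = 2 ^ (r - m) := by simp [BitStr]
  rw [← hc, ← Finset.card_univ]
  refine Finset.card_le_card_of_injOn
    (fun u => fun i : Fin (r - m) => u ⟨m + i, by omega⟩) (fun _ _ => by simp) ?_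
  intro u hu u' hu' h
  simp only [Finset.coe_filter, Finset.mem_univ, true_and, Set.mem_ofPred_eq] at hu hu'
  funext i
  by_cases hi : (i : ℕ) < m
  · have := congrFun (hu.trans hu'.symm) ⟨i, hi⟩
    simpa [truncate] using this
  · have := congrFun h ⟨(i : ℕ) - m, by omega⟩
    simp only at this
    have e : (⟨m + ((i : ℕ) - m), by omega⟩ : Fin r) = i := Fin.ext (by simp; omega)
    rwa [e] at this

theorem law_truncate {Y : Type*} [Fintype Y] {b : Y → ℝ} {r m : ℕ}
    (hmr : m ≤ r) (g : Y → BitStr r) {B : ℝ} (hB : 0 ≤ B)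
    (hg : ∀ u, law b g u ≤ 2 * B / 2 ^ r) (v : BitStr m) :
    law b (fun y => truncate m (g y)) v ≤ 2 * B / 2 ^ m := by
  rw [← law_law b g (truncate m) v]
  have h0 : law (law b g) (truncate m) v
      = ∑ u ∈ univ.filter (fun u : BitStr r => truncate m u = v), law b g u := by
    rw [Finset.sum_filter]
    refine Finset.sum_congr rfl fun u _ => ?_
    congr
  rw [h0]
  calc _ ≤ ∑ u ∈ univ.filter (fun u : BitStr r => truncate m u = v), 2 * B / 2 ^ r :=
        Finset.sum_le_sum fun u _ => hg u
    _ = (univ.filter fun u : BitStr r => truncate m u = v).card * (2 * B / 2 ^ r) := by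
        rw [Finset.sum_const, nsmul_eq_mul]
    _ ≤ 2 ^ (r - m) * (2 * B / 2 ^ r) := by
        gcongr; exact_mod_cast card_trunc_fibre hmr v
    _ = _ := by
        obtain ⟨e, rfl⟩ := Nat.exists_eq_add_of_le hmr
        rw [Nat.add_sub_cancel_left, pow_add]; field_simp

/-- The value `Y^{j+1}` of a row of `SSR`. -/
def ssrY {n rl ℓ M : ℕ} (Extq : BitStr M → BitStr ℓ → BitStr ℓ)
    (Extw : BitStr n → BitStr ℓ → BitStr ℓ) (Ext : BitStr rl → BitStr ℓ → BitStr M)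
    (x : BitStr n) (w : BitStr rl) (ind : ℕ → ℕ) : ℕ → BitStr M
  | 0 => truncate M w
  | j + 1 => Ext w (laR Extq Extw x (ssrY Extq Extw Ext x w ind j)
      (truncate ℓ (ssrY Extq Extw Ext x w ind j)) (ind j))

/-- Data for the analysis of `SSR` on a finite family of rows. -/
structure Ctx (n M ℓ rl : ℕ) (ι Y O : Type*) where
  Extq : BitStr M → BitStr ℓ → BitStr ℓ
  Extw : BitStr n → BitStr ℓ → BitStr ℓ
  Ext : BitStr rl → BitStr ℓ → BitStr M
  ind : ι → ℕ → ℕ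
  i0 : ι
  nb : ℕ
  ybar : ι → Y → BitStr rl
  o : BitStr n → Y → O

variable {n M ℓ rl : ℕ} {ι Y O : Type*} [Fintype ι] [DecidableEq ι] [Fintype Y] [Fintype O]

def Ctx.Yv (c : Ctx n M ℓ rl ι Y O) (i : ι) (j : ℕ) (x : BitStr n) (y : Y) : BitStr M :=
  ssrY c.Extq c.Extw c.Ext x (c.ybar i y) (c.ind i) j

def Ctx.S (c : Ctx n M ℓ rl ι Y O) (i : ι) (j t : ℕ) (x : BitStr n) (y : Y) : BitStr ℓ :=
  laS c.Extq c.Extw x (c.Yv i j x y) (truncate ℓ (c.Yv i j x y)) t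

def Ctx.R (c : Ctx n M ℓ rl ι Y O) (i : ι) (j t : ℕ) (x : BitStr n) (y : Y) : BitStr ℓ :=
  laR c.Extq c.Extw x (c.Yv i j x y) (truncate ℓ (c.Yv i j x y)) t

def Ctx.Vv (c : Ctx n M ℓ rl ι Y O) (i : ι) (j : ℕ) (x : BitStr n) (y : Y) : BitStr ℓ :=
  c.R i j (c.ind i j) x y

def Ctx.Z (c : Ctx n M ℓ rl ι Y O) (x : BitStr n) (y : Y) : BitStr ℓ :=
  c.Vv c.i0 (c.nb - 1) x y

/-- Row `i` agrees with the target row on the first `j` indices. -/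
def Ctx.grp (c : Ctx n M ℓ rl ι Y O) (j : ℕ) (i : ι) : Prop :=
  ∀ j' < j, c.ind i j' = c.ind c.i0 j'

theorem Ctx.R_eq (c : Ctx n M ℓ rl ι Y O) (i : ι) (j t : ℕ) (x : BitStr n) (y : Y) :
    c.R i j t x y = c.Extw x (c.S i j t x y) := rfl

theorem Ctx.S_succ (c : Ctx n M ℓ rl ι Y O) (i : ι) (j t : ℕ) (x : BitStr n) (y : Y) :
    c.S i j (t + 1) x y = c.Extq (c.Yv i j x y) (c.R i j t x y) := rfl

theorem Ctx.S_zero (c : Ctx n M ℓ rl ι Y O) (i : ι) (j : ℕ) (x : BitStr n) (y : Y) :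
    c.S i j 0 x y = truncate ℓ (c.Yv i j x y) := rfl

theorem Ctx.Yv_succ (c : Ctx n M ℓ rl ι Y O) (i : ι) (j : ℕ) (x : BitStr n) (y : Y) :
    c.Yv i (j + 1) x y = c.Ext (c.ybar i y) (c.Vv i j x y) := rfl

theorem Ctx.grp_i0 (c : Ctx n M ℓ rl ι Y O) (j : ℕ) : c.grp j c.i0 := fun _ _ => rfl

theorem Ctx.grp_succ (c : Ctx n M ℓ rl ι Y O) (j : ℕ) (i : ι) :
    c.grp (j + 1) i ↔ c.grp j i ∧ c.ind i j = c.ind c.i0 j := by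
  constructor
  · intro h
    exact ⟨fun j' hj' => h j' (by omega), h j (by omega)⟩
  · rintro ⟨h1, h2⟩ j' hj'
    rcases Nat.lt_succ_iff_lt_or_eq.1 hj' with h | rfl
    · exact h1 j' h
    · exact h2

/-- Standing hypotheses on the data. -/
structure Ctx.OK (c : Ctx n M ℓ rl ι Y O) (ε : ℝ) : Prop where
  ε0 : 0 ≤ ε
  hlM : ℓ ≤ M
  hMr : M ≤ rl
  hq : GoodExt c.Extq (2 ^ (11 * ℓ)) ε
  hw : GoodExt c.Extw (2 ^ (11 * ℓ)) ε
  he : GoodExt c.Ext (2 ^ (2 * M + ℓ)) ε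
  hle : ∀ j < c.nb, ∀ i, c.grp j i → c.ind i j ≤ c.ind c.i0 j
  hne : ∀ i, i ≠ c.i0 → ∃ j < c.nb, c.ind i j ≠ c.ind c.i0 j
  hnb : 0 < c.nb
  hO : ∀ x y x' y', (∀ i, i ≠ c.i0 → c.Vv i (c.nb - 1) x y = c.Vv i (c.nb - 1) x' y') →
    c.o x y = c.o x' y'

/-- Common part of the state of the analysis. -/
structure Ctx.BaseSt (c : Ctx n M ℓ rl ι Y O) (j t : ℕ) (a : BitStr n → ℝ) (b : Y → ℝ)
    (α β βg : ℝ) (G : ι → Y → BitStr M) (vc : ι → BitStr ℓ) : Prop where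
  a0 : ∀ x, 0 ≤ a x
  b0 : ∀ y, 0 ≤ b y
  aα : ∀ x, a x ≤ α
  bβ : ∀ u, law b (c.ybar c.i0) u ≤ β
  bg : ∀ u, law b (G c.i0) u ≤ βg
  hG : ∀ i x y, a x ≠ 0 → b y ≠ 0 → c.grp j i → c.Yv i j x y = G i y
  hv : ∀ i x y, a x ≠ 0 → b y ≠ 0 → (¬ c.grp j i ∨ c.ind i j < t) → c.Vv i j x y = vc i

structure Ctx.SState (c : Ctx n M ℓ rl ι Y O) (j t : ℕ) (a : BitStr n → ℝ) (b : Y → ℝ)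
    (α β βg : ℝ) (G : ι → Y → BitStr M) (vc : ι → BitStr ℓ) (σ : Y → ι → BitStr ℓ) (B : ℝ) :
    Prop where
  base : c.BaseSt j t a b α β βg G vc
  hσ : ∀ i x y, a x ≠ 0 → b y ≠ 0 → c.grp j i → c.S i j t x y = σ y i
  hs : ∀ r, law b (fun y => σ y c.i0) r ≤ 2 * B / Fintype.card (BitStr ℓ)
  hB : mass b ≤ B

structure Ctx.RState (c : Ctx n M ℓ rl ι Y O) (j t : ℕ) (a : BitStr n → ℝ) (b : Y → ℝ)
    (α β βg : ℝ) (G : ι → Y → BitStr M) (vc : ι → BitStr ℓ) (ρ : BitStr n → ι → BitStr ℓ)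
    (A : ℝ) : Prop where
  base : c.BaseSt j t a b α β βg G vc
  hρ : ∀ i x y, a x ≠ 0 → b y ≠ 0 → c.grp j i → c.R i j t x y = ρ x i
  hs : ∀ r, law a (fun x => ρ x c.i0) r ≤ 2 * A / Fintype.card (BitStr ℓ)
  hA : mass a ≤ A

def Ctx.SBound (c : Ctx n M ℓ rl ι Y O) (ε : ℝ) (j t : ℕ) (N ni cX cY cg : ℝ) : Prop :=
  ∀ a b α β βg G vc σ B, c.SState j t a b α β βg G vc σ B →
    defect a b c.o c.Z ≤ 4 * ε * (mass a + α * cX) * (N * (B + β * cY) + ni * (βg * cg))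

def Ctx.RBound (c : Ctx n M ℓ rl ι Y O) (ε : ℝ) (j t : ℕ) (N ni cX cY cg : ℝ) : Prop :=
  ∀ a b α β βg G vc ρ A, c.RState j t a b α β βg G vc ρ A →
    defect a b c.o c.Z ≤ 4 * ε * (A + α * cX) * (N * (mass b + β * cY) + ni * (βg * cg))

theorem law_id {X : Type*} [Fintype X] (a : X → ℝ) (u : X) : law a (fun x => x) u = a u := by
  unfold law; simp

theorem Ctx.BaseSt.α0 {c : Ctx n M ℓ rl ι Y O} {j t : ℕ} {a : BitStr n → ℝ} {b : Y → ℝ}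
    {α β βg : ℝ} {G : ι → Y → BitStr M} {vc : ι → BitStr ℓ}
    (h : c.BaseSt j t a b α β βg G vc) : 0 ≤ α := (h.a0 (fun _ => false)).trans (h.aα _)

theorem Ctx.BaseSt.β0 {c : Ctx n M ℓ rl ι Y O} {j t : ℕ} {a : BitStr n → ℝ} {b : Y → ℝ}
    {α β βg : ℝ} {G : ι → Y → BitStr M} {vc : ι → BitStr ℓ}
    (h : c.BaseSt j t a b α β βg G vc) : 0 ≤ β :=
  (law_nonneg h.b0 _ (fun _ => false)).trans (h.bβ _)

theorem Ctx.BaseSt.βg0 {c : Ctx n M ℓ rl ι Y O} {j t : ℕ} {a : BitStr n → ℝ} {b : Y → ℝ}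
    {α β βg : ℝ} {G : ι → Y → BitStr M} {vc : ι → BitStr ℓ}
    (h : c.BaseSt j t a b α β βg G vc) : 0 ≤ βg :=
  (law_nonneg h.b0 _ (fun _ => false)).trans (h.bg _)

theorem Ctx.SBound.mono {c : Ctx n M ℓ rl ι Y O} {ε : ℝ} {j t : ℕ} {N ni cX cY cg : ℝ}
    (h : c.SBound ε j t N ni cX cY cg) (hε : 0 ≤ ε) (hN : 0 ≤ N) (hni : 0 ≤ ni) (hX : 0 ≤ cX)
    (hY : 0 ≤ cY) (hg : 0 ≤ cg)
    {N' ni' cX' cY' cg' : ℝ} (h1 : N ≤ N') (h2 : ni ≤ ni') (h3 : cX ≤ cX') (h4 : cY ≤ cY')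
    (h5 : cg ≤ cg') : c.SBound ε j t N' ni' cX' cY' cg' := by
  intro a b α β βg G vc σ B hs
  refine (h a b α β βg G vc σ B hs).trans ?_
  have ha := mass_nonneg hs.base.a0
  have hb := mass_nonneg hs.base.b0
  have := hs.base.α0
  have := hs.base.β0
  have := hs.base.βg0
  have hB := hb.trans hs.hB
  have := hX.trans h3
  have := hN.trans h1
  have := hni.trans h2
  have := hY.trans h4
  gcongr

theorem Ctx.final {c : Ctx n M ℓ rl ι Y O} {ε : ℝ} (ok : c.OK ε) {cX cY cg : ℝ}
    (hX : 2 ^ (11 * ℓ) ≤ cX) (hY : 0 ≤ cY) :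
    c.SBound ε (c.nb - 1) (c.ind c.i0 (c.nb - 1)) 1 0 cX cY cg := by
  intro a b α β βg G vc σ B hs
  have ha := mass_nonneg hs.base.a0
  have hb := mass_nonneg hs.base.b0
  have hα := hs.base.α0
  have hβ := hs.base.β0
  have hB := hb.trans hs.hB
  have hnb := ok.hnb
  have ε0 := ok.ε0
  have hvc : ∀ i x y, a x ≠ 0 → b y ≠ 0 → i ≠ c.i0 → c.Vv i (c.nb - 1) x y = vc i := by
    intro i x y hx hy hi
    refine hs.base.hv i x y hx hy ?_
    by_cases hg : c.grp (c.nb - 1) i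
    · right
      refine lt_of_le_of_ne (ok.hle _ (by omega) i hg) ?_
      intro he
      obtain ⟨j, hj, hjn⟩ := ok.hne i hi
      rcases Nat.lt_or_ge j (c.nb - 1) with h | h
      · exact hjn (hg j h)
      · have : j = c.nb - 1 := by omega
        exact hjn (this ▸ he)
    · exact Or.inl hg
  have := step_final ok.hw hs.base.a0 hs.base.b0 c.o c.Z (fun x => x)
    (κ := α) (fun u => by rw [law_id]; exact hs.base.aα u)
    (σ := fun y => σ y c.i0) hB hs.hs
    (fun x y hx hy => by
      change c.Extw x (c.S c.i0 _ _ x y) = _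
      rw [hs.hσ c.i0 x y hx hy (c.grp_i0 _)])
    (fun x y x' y' hx hy hx' hy' => ok.hO _ _ _ _ fun i hi => by
      rw [hvc i x y hx hy hi, hvc i x' y' hx' hy' hi])
  refine this.trans ?_
  calc 2 * ε * B * (mass a + 2 ^ (11 * ℓ) * α) ≤ 2 * ε * B * (mass a + cX * α) := by gcongr
    _ = 2 * ε * (mass a + α * cX) * (1 * (B + 0) + 0 ) := by ring
    _ ≤ 4 * ε * (mass a + α * cX) * (1 * (B + β * cY) + 0 * (βg * cg)) := by
      rw [zero_mul]
      have : 0 ≤ α * cX := mul_nonneg hα (le_trans (by positivity) hX)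
      gcongr
      · norm_num
      · positivity

theorem Ctx.S_of_R {c : Ctx n M ℓ rl ι Y O} {ε : ℝ} (ok : c.OK ε) {j t : ℕ}
    {N ni cX cY cg : ℝ} (h : c.RBound ε j t N ni cX cY cg)
    (hX : 2 ^ (11 * ℓ) ≤ cX) (hY : 0 ≤ cY) (hN : 0 ≤ N) :
    c.SBound ε j t (N + 1) ni cX (Fintype.card (ι → BitStr ℓ) * cY)
      (Fintype.card (ι → BitStr ℓ) * cg) := by
  intro a b α β βg G vc σ B hs
  have ha := mass_nonneg hs.base.a0
  have hb := mass_nonneg hs.base.b0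
  have hα := hs.base.α0
  have hβ := hs.base.β0
  have hB := hb.trans hs.hB
  have ε0 := ok.ε0
  have hX0 : 0 ≤ cX := le_trans (by positivity) hX
  have hstep := step_YX c.i0 ok.hw hs.base.a0 hs.base.b0 c.o c.Z (fun x => x)
    (κ := α) (fun u => by rw [law_id]; exact hs.base.aα u) hB hs.hs
  refine hstep.trans ?_
  have hc : ∀ e : ι → BitStr ℓ,
      defect (lightR a (fun x => c.Extw x (e c.i0))) (restr b (fun y => σ y = e)) c.o c.Z ≤
      4 * ε * (mass a + α * cX) * (N * (mass (restr b (fun y => σ y = e)) + β * cY)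
        + ni * (βg * cg)) := by
    intro e
    refine h _ _ α β βg G vc (fun x i => c.Extw x (e i)) (mass a) ⟨⟨?_, ?_, ?_, ?_, ?_, ?_, ?_⟩,
      ?_, ?_, ?_⟩
    · exact lightR_nonneg hs.base.a0 _
    · exact restr_nonneg hs.base.b0 _
    · exact fun x => (lightR_le hs.base.a0 _ x).trans (hs.base.aα x)
    · exact fun u => (law_mono (restr_le hs.base.b0 _) _ u).trans (hs.base.bβ u)
    · exact fun u => (law_mono (restr_le hs.base.b0 _) _ u).trans (hs.base.bg u)
    · exact fun i x y hx hy => hs.base.hG i x y (restr_ne hx).2 (restr_ne hy).2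
    · exact fun i x y hx hy => hs.base.hv i x y (restr_ne hx).2 (restr_ne hy).2
    · intro i x y hx hy hg
      rw [c.R_eq, hs.hσ i x y (restr_ne hx).2 (restr_ne hy).2 hg, (restr_ne hy).1]
    · exact fun r => law_lightR hs.base.a0 _ r
    · exact mass_mono (lightR_le hs.base.a0 _)
  have hsum := Finset.sum_le_sum fun (e : ι → BitStr ℓ) (_ : e ∈ univ) => hc e
  have hm : ∑ e, mass (restr b (fun y => σ y = e)) = mass b := sum_mass_restr b σ
  rw [← Finset.mul_sum, Finset.sum_add_distrib, ← Finset.mul_sum, Finset.sum_add_distrib, hm,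
    Finset.sum_const, Finset.sum_const, nsmul_eq_mul, nsmul_eq_mul, Finset.card_univ] at hsum
  set Λ : ℝ := (Fintype.card (ι → BitStr ℓ) : ℝ) with hΛ
  have hΛ0 : 0 ≤ Λ := by positivity
  have e1 : 4 * ε * B * (mass a + 2 ^ (11 * ℓ) * α)
      ≤ 4 * ε * (mass a + α * cX) * (B + β * (Λ * cY)) := by
    calc _ ≤ 4 * ε * B * (mass a + cX * α) := by gcongr
      _ = 4 * ε * (mass a + α * cX) * (B + 0) := by ring
      _ ≤ _ := by gcongr; positivity
  have e2 : 4 * ε * (mass a + α * cX) * (N * (mass b + Λ * (β * cY)) + Λ * (ni * (βg * cg)))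
      ≤ 4 * ε * (mass a + α * cX) * (N * (B + Λ * (β * cY)) + Λ * (ni * (βg * cg))) := by
    gcongr; exact hs.hB
  have e3 : 4 * ε * (mass a + α * cX) * ((N + 1) * (B + β * (Λ * cY)) + ni * (βg * (Λ * cg)))
      = 4 * ε * (mass a + α * cX) * (B + β * (Λ * cY)) +
        4 * ε * (mass a + α * cX) * (N * (B + Λ * (β * cY)) + Λ * (ni * (βg * cg))) := by ring
  linarith

theorem Ctx.R_of_S {c : Ctx n M ℓ rl ι Y O} {ε : ℝ} (ok : c.OK ε) {j t : ℕ}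
    {N ni cX cY cg : ℝ} (h : c.SBound ε j (t + 1) N ni cX cY cg)
    (hX : 0 ≤ cX) (hY : 0 ≤ cY) (hg : 2 ^ (11 * ℓ) ≤ cg) (hN : 0 ≤ N) (hni : 0 ≤ ni) :
    c.RBound ε j t (N + 1) (ni + 1) (Fintype.card (ι → BitStr ℓ) * cX) cY cg := by
  intro a b α β βg G vc ρ A hs
  have ha := mass_nonneg hs.base.a0
  have hb := mass_nonneg hs.base.b0
  have hα := hs.base.α0
  have hβ := hs.base.β0
  have hβg := hs.base.βg0
  have hA := ha.trans hs.hA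
  have ε0 := ok.ε0
  have hg0 : 0 ≤ cg := le_trans (by positivity) hg
  have hstep := step_XY c.i0 ok.hq hs.base.a0 hs.base.b0 c.o c.Z (G c.i0)
    (κ := βg) hs.base.bg hA hs.hs
  refine hstep.trans ?_
  have hc : ∀ e : ι → BitStr ℓ,
      defect (restr a (fun x => ρ x = e)) (lightR b (fun y => c.Extq (G c.i0 y) (e c.i0))) c.o c.Z
      ≤ 4 * ε * (mass (restr a (fun x => ρ x = e)) + α * cX) * (N * (mass b + β * cY)
        + ni * (βg * cg)) := by
    intro e
    refine h _ _ α β βg G (fun i => if c.grp j i ∧ c.ind i j = t then e i else vc i)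
      (fun y i => c.Extq (G i y) (e i)) (mass b) ⟨⟨?_, ?_, ?_, ?_, ?_, ?_, ?_⟩,
      ?_, ?_, ?_⟩
    · exact restr_nonneg hs.base.a0 _
    · exact lightR_nonneg hs.base.b0 _
    · exact fun x => (restr_le hs.base.a0 _ x).trans (hs.base.aα x)
    · exact fun u => (law_mono (lightR_le hs.base.b0 _) _ u).trans (hs.base.bβ u)
    · exact fun u => (law_mono (lightR_le hs.base.b0 _) _ u).trans (hs.base.bg u)
    · exact fun i x y hx hy => hs.base.hG i x y (restr_ne hx).2 (restr_ne hy).2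
    · intro i x y hx hy hi
      split_ifs with hgi
      · have := hs.hρ i x y (restr_ne hx).2 (restr_ne hy).2 hgi.1
        rw [← (restr_ne hx).1, ← this, Ctx.Vv, hgi.2]
      · refine hs.base.hv i x y (restr_ne hx).2 (restr_ne hy).2 ?_
        by_cases hgr : c.grp j i
        · right
          have : ¬ c.ind i j = t := fun h' => hgi ⟨hgr, h'⟩
          rcases hi with hi | hi
          · exact absurd hgr hi
          · omega
        · exact Or.inl hgr
    · intro i x y hx hy hgr
      rw [c.S_succ, hs.base.hG i x y (restr_ne hx).2 (restr_ne hy).2 hgr,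
        hs.hρ i x y (restr_ne hx).2 (restr_ne hy).2 hgr, (restr_ne hx).1]
    · exact fun r => law_lightR hs.base.b0 _ r
    · exact mass_mono (lightR_le hs.base.b0 _)
  have hsum := Finset.sum_le_sum fun (e : ι → BitStr ℓ) (_ : e ∈ univ) => hc e
  have hm : ∑ e, mass (restr a (fun y => ρ y = e)) = mass a := sum_mass_restr a ρ
  rw [← Finset.sum_mul, ← Finset.mul_sum, Finset.sum_add_distrib, hm,
    Finset.sum_const, nsmul_eq_mul, Finset.card_univ] at hsum
  set Λ : ℝ := (Fintype.card (ι → BitStr ℓ) : ℝ) with hΛ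
  have hΛ0 : 0 ≤ Λ := by positivity
  have e1 : 4 * ε * A * (mass b + 2 ^ (11 * ℓ) * βg)
      ≤ 4 * ε * (A + α * (Λ * cX)) * ((mass b + β * cY) + βg * cg) := by
    calc _ ≤ 4 * ε * A * (mass b + cg * βg) := by gcongr
      _ = 4 * ε * (A + 0) * ((mass b + 0) + βg * cg) := by ring
      _ ≤ _ := by gcongr <;> positivity
  have e2 : 4 * ε * (mass a + Λ * (α * cX)) * (N * (mass b + β * cY) + ni * (βg * cg))
      ≤ 4 * ε * (A + Λ * (α * cX)) * (N * (mass b + β * cY) + ni * (βg * cg)) := by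
    gcongr; exact hs.hA
  have e3 : 4 * ε * (A + α * (Λ * cX)) * ((N + 1) * (mass b + β * cY) + (ni + 1) * (βg * cg))
      = 4 * ε * (A + α * (Λ * cX)) * ((mass b + β * cY) + βg * cg) +
        4 * ε * (A + Λ * (α * cX)) * (N * (mass b + β * cY) + ni * (βg * cg)) := by ring
  linarith

end SSRAnalysis

set_option linter.unusedSectionVars false
section SSRAnalysis2
open Classical
variable {n M ℓ rl : ℕ} {ι Y O : Type*} [Fintype ι] [DecidableEq ι] [Fintype Y] [Fintype O]

theorem Ctx.round {c : Ctx n M ℓ rl ι Y O} {ε : ℝ} (ok : c.OK ε) {j : ℕ} (hj : j + 1 < c.nb)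
    {N ni cX cY cg cg' : ℝ} (h : c.SBound ε (j + 1) 0 N ni cX cY cg)
    (hX : 0 ≤ cX) (hY : 2 ^ (2 * M + ℓ) ≤ cY) (hg0 : 0 ≤ cg) (hg : 2 * cg ≤ 2 ^ M)
    (hN : 0 ≤ N) (hni : 0 ≤ ni) :
    c.RBound ε j (c.ind c.i0 j) (N + ni + 1) 0
      (Fintype.card (ι → BitStr ℓ) * (Fintype.card (ι → BitStr ℓ) * cX))
      (Fintype.card (ι → BitStr M) * cY) cg' := by
  intro a b α β βg G vc ρ A hs
  have ha := mass_nonneg hs.base.a0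
  have hb := mass_nonneg hs.base.b0
  have hα := hs.base.α0
  have hβ := hs.base.β0
  have hβg := hs.base.βg0
  have hA := ha.trans hs.hA
  have ε0 := ok.ε0
  have hY0 : 0 ≤ cY := le_trans (by positivity) hY
  set Λ : ℝ := (Fintype.card (ι → BitStr ℓ) : ℝ) with hΛ
  have hΛ0 : 0 ≤ Λ := by positivity
  set ΛM : ℝ := (Fintype.card (ι → BitStr M) : ℝ) with hΛM
  have hΛM0 : 0 ≤ ΛM := by positivity
  -- the values `Y^{j+1}` of the rows that are already fixed
  let μ : Y → ι → BitStr M := fun y i => c.Ext (c.ybar i y) (vc i)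
  rw [defect_split_Y a b c.o c.Z μ]
  have hm : ∀ m : ι → BitStr M, defect a (restr b (fun y => μ y = m)) c.o c.Z ≤
      4 * ε * (A + α * (Λ * (Λ * cX))) *
        ((N + ni + 1) * (mass (restr b (fun y => μ y = m)) + β * cY)) := by
    intro m
    set bm := restr b (fun y => μ y = m) with hbm
    have bm0 : ∀ y, 0 ≤ bm y := restr_nonneg hs.base.b0 _
    have bmβ : ∀ u, law bm (c.ybar c.i0) u ≤ β :=
      fun u => (law_mono (restr_le hs.base.b0 _) _ u).trans (hs.base.bβ u)
    have hbm0 := mass_nonneg bm0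
    have hstep := step_XY c.i0 ok.he hs.base.a0 bm0 c.o c.Z (c.ybar c.i0)
      (κ := β) bmβ hA hs.hs
    refine hstep.trans ?_
    let ν : BitStr n → ι → BitStr ℓ :=
      fun x i => laR c.Extq c.Extw x (m i) (truncate ℓ (m i)) (c.ind i (j + 1))
    have hc : ∀ e : ι → BitStr ℓ,
        defect (restr a (fun x => ρ x = e))
          (lightR bm (fun y => c.Ext (c.ybar c.i0 y) (e c.i0))) c.o c.Z
        ≤ 4 * ε * (mass (restr a (fun x => ρ x = e)) + α * (Λ * cX)) *
          ((N + ni) * (mass bm + β * cY)) := by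
      intro e
      set ae := restr a (fun x => ρ x = e) with hae
      set be := lightR bm (fun y => c.Ext (c.ybar c.i0 y) (e c.i0)) with hbe
      have ae0 : ∀ x, 0 ≤ ae x := restr_nonneg hs.base.a0 _
      have be0 : ∀ x, 0 ≤ be x := lightR_nonneg bm0 _
      have hlawM : ∀ u, law be (fun y => c.Ext (c.ybar c.i0 y) (e c.i0)) u
          ≤ 2 * mass bm / 2 ^ M := by
        intro u
        have := law_lightR bm0 (fun y => c.Ext (c.ybar c.i0 y) (e c.i0)) u
        rwa [card_bitStr] at this
      have hw : ∀ w : ι → BitStr ℓ, defect (restr ae (fun x => ν x = w)) be c.o c.Z ≤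
          4 * ε * (mass (restr ae (fun x => ν x = w)) + α * cX) *
            (N * (mass bm + β * cY) + ni * ((2 * mass bm / 2 ^ M) * cg)) := by
        intro w
        refine h _ _ α β _ (fun i y => c.Ext (c.ybar i y) (e i)) w
          (fun y i => truncate ℓ (c.Ext (c.ybar i y) (e i))) (mass bm)
          ⟨⟨?_, ?_, ?_, ?_, ?_, ?_, ?_⟩, ?_, ?_, ?_⟩
        · exact restr_nonneg ae0 _
        · exact be0
        · exact fun x => (restr_le ae0 _ x).trans
            ((restr_le hs.base.a0 _ x).trans (hs.base.aα x))
        · exact fun u => (law_mono (lightR_le bm0 _) _ u).trans (bmβ u)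
        · exact hlawM
        · intro i x y hx hy hgr
          rw [c.grp_succ] at hgr
          have hx1 := restr_ne hx
          have hx2 := restr_ne hx1.2
          have hy1 := restr_ne hy
          have hy2 := restr_ne hy1.2
          rw [c.Yv_succ]
          have h1 := hs.hρ i x y hx2.2 hy2.2 hgr.1
          rw [Ctx.Vv, hgr.2, h1, hx2.1]
        · intro i x y hx hy hgr
          have hx1 := restr_ne hx
          have hx2 := restr_ne hx1.2
          have hy1 := restr_ne hy
          have hy2 := restr_ne hy1.2
          have hgr' : ¬ c.grp (j + 1) i := by
            rcases hgr with hgr | hgr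
            · exact hgr
            · exact absurd hgr (Nat.not_lt_zero _)
          have h1 : c.Vv i j x y = vc i := by
            refine hs.base.hv i x y hx2.2 hy2.2 ?_
            by_cases hg1 : c.grp j i
            · right
              refine lt_of_le_of_ne (ok.hle _ (by omega) i hg1) ?_
              intro he
              exact hgr' ((c.grp_succ j i).2 ⟨hg1, he⟩)
            · exact Or.inl hg1
          have h2 : c.Yv i (j + 1) x y = m i := by
            rw [c.Yv_succ, h1, ← hy2.1]
          rw [← hx1.1, Ctx.Vv, Ctx.R, h2]
        · intro i x y hx hy hgr
          rw [c.grp_succ] at hgr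
          have hx1 := restr_ne hx
          have hx2 := restr_ne hx1.2
          have hy1 := restr_ne hy
          have hy2 := restr_ne hy1.2
          have h1 := hs.hρ i x y hx2.2 hy2.2 hgr.1
          rw [c.S_zero, c.Yv_succ, Ctx.Vv, hgr.2, h1, hx2.1]
        · intro r
          rw [card_bitStr]
          exact law_truncate ok.hlM (fun y => c.Ext (c.ybar c.i0 y) (e c.i0)) hbm0 hlawM r
        · exact mass_mono (lightR_le bm0 _)
      refine (defect_split_X be0 ae c.o c.Z ν).trans ?_
      have hsum := Finset.sum_le_sum fun (w : ι → BitStr ℓ) (_ : w ∈ univ) => hw w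
      have hmm : ∑ w, mass (restr ae (fun y => ν y = w)) = mass ae := sum_mass_restr ae ν
      rw [← Finset.sum_mul, ← Finset.mul_sum, Finset.sum_add_distrib, hmm,
        Finset.sum_const, nsmul_eq_mul, Finset.card_univ] at hsum
      refine hsum.trans ?_
      have hmae := mass_nonneg ae0
      have e1 : (2 * mass bm / 2 ^ M) * cg ≤ mass bm + β * cY := by
        have : (2 * mass bm / 2 ^ M) * cg = mass bm * ((2 * cg) / 2 ^ M) := by ring
        rw [this]
        have h1 : (2 * cg) / 2 ^ M ≤ 1 := by
          rw [div_le_one (by positivity)]; exact hg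
        have h2 := mul_le_mul_of_nonneg_left h1 hbm0
        have h3 : 0 ≤ β * cY := by positivity
        linarith
      calc _ ≤ 4 * ε * (mass ae + Λ * (α * cX)) *
            (N * (mass bm + β * cY) + ni * (mass bm + β * cY)) := by gcongr
        _ = _ := by ring
    have hsum := Finset.sum_le_sum fun (e : ι → BitStr ℓ) (_ : e ∈ univ) => hc e
    have hmm : ∑ e, mass (restr a (fun y => ρ y = e)) = mass a := sum_mass_restr a ρ
    rw [← Finset.sum_mul, ← Finset.mul_sum, Finset.sum_add_distrib, hmm,
      Finset.sum_const, nsmul_eq_mul, Finset.card_univ] at hsum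
    have e1 : 4 * ε * A * (mass bm + 2 ^ (2 * M + ℓ) * β)
        ≤ 4 * ε * (A + α * (Λ * (Λ * cX))) * (mass bm + β * cY) := by
      calc _ ≤ 4 * ε * A * (mass bm + cY * β) := by gcongr
        _ = 4 * ε * (A + 0) * (mass bm + β * cY) := by ring
        _ ≤ _ := by gcongr; positivity
    have e2 : 4 * ε * (mass a + Λ * (α * (Λ * cX))) * ((N + ni) * (mass bm + β * cY))
        ≤ 4 * ε * (A + Λ * (α * (Λ * cX))) * ((N + ni) * (mass bm + β * cY)) := by
      gcongr; exact hs.hA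
    have e3 : 4 * ε * (A + α * (Λ * (Λ * cX))) * ((N + ni + 1) * (mass bm + β * cY))
        = 4 * ε * (A + α * (Λ * (Λ * cX))) * (mass bm + β * cY) +
          4 * ε * (A + Λ * (α * (Λ * cX))) * ((N + ni) * (mass bm + β * cY)) := by ring
    linarith
  have hsum := Finset.sum_le_sum fun (m : ι → BitStr M) (_ : m ∈ univ) => hm m
  have hmm : ∑ m, mass (restr b (fun y => μ y = m)) = mass b := sum_mass_restr b μ
  rw [← Finset.mul_sum, ← Finset.mul_sum, Finset.sum_add_distrib, hmm,
    Finset.sum_const, nsmul_eq_mul, Finset.card_univ] at hsum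
  refine hsum.trans (le_of_eq ?_)
  ring

/-- Descending inside one look-ahead block. -/
theorem Ctx.inner {c : Ctx n M ℓ rl ι Y O} {ε : ℝ} (ok : c.OK ε) {j : ℕ} (s : ℕ) :
    ∀ {N ni cX cY cg : ℝ}, 
    2 ^ (11 * ℓ) ≤ cX → 0 ≤ cY → 2 ^ (11 * ℓ) ≤ cg → 0 ≤ N → 0 ≤ ni →
    c.SBound ε j s N ni cX cY cg →
    c.SBound ε j 0 (N + 2 * s) (ni + s) ((Fintype.card (ι → BitStr ℓ) : ℝ) ^ s * cX)
      ((Fintype.card (ι → BitStr ℓ) : ℝ) ^ s * cY)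
      ((Fintype.card (ι → BitStr ℓ) : ℝ) ^ s * cg) := by
  have hΛ1 : (1 : ℝ) ≤ (Fintype.card (ι → BitStr ℓ) : ℝ) := by
    exact_mod_cast Fintype.card_pos
  induction s with
  | zero =>
    intro N ni cX cY cg _ _ _ _ _ h
    simpa using h
  | succ s ih =>
    intro N ni cX cY cg hX hY hg hN hni h
    have hX0 : 0 ≤ cX := le_trans (by positivity) hX
    have hg0 : 0 ≤ cg := le_trans (by positivity) hg
    have hX' : 2 ^ (11 * ℓ) ≤ (Fintype.card (ι → BitStr ℓ) : ℝ) * cX :=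
      hX.trans (le_mul_of_one_le_left hX0 hΛ1)
    have hg' : 2 ^ (11 * ℓ) ≤ (Fintype.card (ι → BitStr ℓ) : ℝ) * cg :=
      hg.trans (le_mul_of_one_le_left hg0 hΛ1)
    have h1 := Ctx.S_of_R ok (Ctx.R_of_S ok h hX0 hY hg hN hni) hX' hY (by linarith)
    have h2 := ih hX' (by positivity) hg' (by linarith) (by linarith) h1
    convert h2 using 1 <;> push_cast <;> ring

/-- The whole analysis of `SSR`. -/
theorem Ctx.main {c : Ctx n M ℓ rl ι Y O} {ε : ℝ} (ok : c.OK ε) {h : ℕ}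
    (hh : ∀ j, c.ind c.i0 j < h)
    (hg : 2 * ((Fintype.card (ι → BitStr ℓ) : ℝ) ^ h * 2 ^ (11 * ℓ)) ≤ 2 ^ M) :
    ∀ m : ℕ, m < c.nb → c.SBound ε (c.nb - 1 - m) 0 ((m + 1 : ℕ) * (3 * h + 2)) h
      (((Fintype.card (ι → BitStr ℓ) : ℝ) ^ (h + 1)) ^ (m + 1) * 2 ^ (11 * ℓ))
      (((Fintype.card (ι → BitStr ℓ) : ℝ) ^ h * (Fintype.card (ι → BitStr M) : ℝ)) ^ (m + 1)
        * 2 ^ (2 * M + ℓ))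
      ((Fintype.card (ι → BitStr ℓ) : ℝ) ^ h * 2 ^ (11 * ℓ)) := by
  have hΛ1 : (1 : ℝ) ≤ (Fintype.card (ι → BitStr ℓ) : ℝ) := by
    exact_mod_cast Fintype.card_pos
  have hΛM1 : (1 : ℝ) ≤ (Fintype.card (ι → BitStr M) : ℝ) := by
    exact_mod_cast Fintype.card_pos
  set Λ : ℝ := (Fintype.card (ι → BitStr ℓ) : ℝ) with hΛ
  set ΛM : ℝ := (Fintype.card (ι → BitStr M) : ℝ) with hΛM
  have hΛ0 : 0 ≤ Λ := by positivity
  have hΛM0 : 0 ≤ ΛM := by positivity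
  have ε0 := ok.ε0
  intro m
  induction m with
  | zero =>
    intro _
    set s := c.ind c.i0 (c.nb - 1) with hs
    have hsh : s < h := hh _
    have hshR : (s : ℝ) ≤ h := by exact_mod_cast hsh.le
    have h0 := Ctx.final ok (cX := 2 ^ (11 * ℓ)) (cY := 2 ^ (2 * M + ℓ)) (cg := 2 ^ (11 * ℓ))
      le_rfl (by positivity)
    have h1 := Ctx.inner ok s le_rfl (by positivity) le_rfl (by norm_num) le_rfl h0
    refine h1.mono ε0 (by positivity) (by positivity) (by positivity) (by positivity)
      (by positivity) ?_ ?_ ?_ ?_ ?_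
    · push_cast; linarith
    · linarith
    · gcongr
      rw [zero_add, pow_one]
      exact pow_le_pow_right₀ hΛ1 (by omega)
    · gcongr
      rw [zero_add, pow_one]
      calc Λ ^ s ≤ Λ ^ h := pow_le_pow_right₀ hΛ1 hsh.le
        _ ≤ _ := le_mul_of_one_le_right (by positivity) hΛM1
    · refine mul_le_mul_of_nonneg_right (pow_le_pow_right₀ hΛ1 (by omega)) (by positivity)
  | succ m ih =>
    intro hm
    have h0 := ih (by omega)
    obtain ⟨j, hj⟩ : ∃ j, c.nb - 1 - (m + 1) = j := ⟨_, rfl⟩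
    have hj1 : c.nb - 1 - m = j + 1 := by omega
    rw [hj1] at h0
    rw [hj]
    set s := c.ind c.i0 j with hs
    have hsh : s < h := hh _
    have hshR : (s : ℝ) ≤ h := by exact_mod_cast hsh.le
    have hone : ∀ e, 1 ≤ (Λ ^ h * ΛM) ^ e := fun e =>
      one_le_pow₀ (one_le_mul_of_one_le_of_one_le (one_le_pow₀ hΛ1) hΛM1)
    have hone' : ∀ e, 1 ≤ (Λ ^ (h+1)) ^ e := fun e => one_le_pow₀ (one_le_pow₀ hΛ1)
    have h1 := Ctx.round ok (cg' := 2 ^ (11 * ℓ)) (by omega) h0 (by positivity)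
      (le_mul_of_one_le_left (by positivity) (hone _)) (by positivity) hg (by positivity)
      (by positivity)
    have hX : 2 ^ (11 * ℓ) ≤ Λ * (Λ * ((Λ ^ (h + 1)) ^ (m + 1) * 2 ^ (11 * ℓ))) := by
      rw [← mul_assoc, ← mul_assoc]
      refine le_mul_of_one_le_left (by positivity) ?_
      exact one_le_mul_of_one_le_of_one_le (one_le_mul_of_one_le_of_one_le hΛ1 hΛ1) (hone' _)
    have h2 := Ctx.S_of_R ok h1 hX (by positivity) (by positivity)
    have h3 := Ctx.inner ok s hX (by positivity)
      (le_mul_of_one_le_left (by positivity) hΛ1) (by positivity) le_rfl h2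
    refine h3.mono ε0 (by positivity) (by positivity) (by positivity) (by positivity)
      (by positivity) ?_ ?_ ?_ ?_ ?_
    · push_cast; linarith
    · linarith
    · calc Λ ^ s * (Λ * (Λ * ((Λ ^ (h + 1)) ^ (m + 1) * 2 ^ (11 * ℓ))))
          = Λ ^ (s + 2) * ((Λ ^ (h + 1)) ^ (m + 1) * 2 ^ (11 * ℓ)) := by ring
        _ ≤ Λ ^ (h + 1) * ((Λ ^ (h + 1)) ^ (m + 1) * 2 ^ (11 * ℓ)) := by
          refine mul_le_mul_of_nonneg_right (pow_le_pow_right₀ hΛ1 (by omega)) (by positivity)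
        _ = _ := by ring
    · calc Λ ^ s * (Λ * (ΛM * ((Λ ^ h * ΛM) ^ (m + 1) * 2 ^ (2 * M + ℓ))))
          = Λ ^ (s + 1) * (ΛM * ((Λ ^ h * ΛM) ^ (m + 1) * 2 ^ (2 * M + ℓ))) := by ring
        _ ≤ Λ ^ h * (ΛM * ((Λ ^ h * ΛM) ^ (m + 1) * 2 ^ (2 * M + ℓ))) := by
          refine mul_le_mul_of_nonneg_right (pow_le_pow_right₀ hΛ1 (by omega)) (by positivity)
        _ = _ := by ring
    · calc Λ ^ s * (Λ * 2 ^ (11 * ℓ)) = Λ ^ (s + 1) * 2 ^ (11 * ℓ) := by ring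
        _ ≤ _ := by
          refine mul_le_mul_of_nonneg_right (pow_le_pow_right₀ hΛ1 (by omega)) (by positivity)

/-- Conclusion for rows whose target row is nearly uniform. -/
theorem Ctx.claim {c : Ctx n M ℓ rl ι Y O} {ε : ℝ} (ok : c.OK ε) {h : ℕ}
    (hh : ∀ j, c.ind c.i0 j < h)
    (hg : 2 * ((Fintype.card (ι → BitStr ℓ) : ℝ) ^ h * 2 ^ (11 * ℓ)) ≤ 2 ^ M)
    (hy : 2 * (((Fintype.card (ι → BitStr ℓ) : ℝ) ^ h * (Fintype.card (ι → BitStr M) : ℝ)) ^ c.nb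
        * 2 ^ (2 * M + ℓ)) ≤ 2 ^ rl)
    {a : BitStr n → ℝ} {b : Y → ℝ} (ha : ∀ x, 0 ≤ a x) (hb : ∀ y, 0 ≤ b y) {α B : ℝ}
    (haα : ∀ x, a x ≤ α) (hbB : mass b ≤ B)
    (hlaw : ∀ u, law b (c.ybar c.i0) u ≤ 2 * B / 2 ^ rl) :
    defect a b c.o c.Z ≤ 4 * ε * (mass a + α *
      (((Fintype.card (ι → BitStr ℓ) : ℝ) ^ (h + 1)) ^ c.nb * 2 ^ (11 * ℓ))) *
      ((2 * (c.nb * (3 * h + 2)) + h) * B) := by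
  have hnb := ok.hnb
  have h0 := Ctx.main ok hh hg (c.nb - 1) (by omega)
  have e1 : c.nb - 1 + 1 = c.nb := by omega
  rw [Nat.sub_self, e1] at h0
  have hB : 0 ≤ B := (mass_nonneg hb).trans hbB
  have hα : 0 ≤ α := (ha (fun _ => false)).trans (haα _)
  have hmM := law_truncate ok.hMr (c.ybar c.i0) hB hlaw
  have := h0 a b α (2 * B / 2 ^ rl) (2 * B / 2 ^ M) (fun i y => truncate M (c.ybar i y))
    (fun _ _ => false) (fun y i => truncate ℓ (truncate M (c.ybar i y))) B
    ⟨⟨ha, hb, haα, hlaw, hmM, fun _ _ _ _ _ _ => rfl, ?_⟩, fun _ _ _ _ _ _ => rfl, ?_, hbB⟩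
  · refine this.trans ?_
    have ε0 := ok.ε0
    have hma := mass_nonneg ha
    set cY : ℝ := (((Fintype.card (ι → BitStr ℓ) : ℝ) ^ h * (Fintype.card (ι → BitStr M) : ℝ))
      ^ c.nb * 2 ^ (2 * M + ℓ)) with hcY
    set cg : ℝ := (Fintype.card (ι → BitStr ℓ) : ℝ) ^ h * 2 ^ (11 * ℓ) with hcg
    have q1 : 2 * B / 2 ^ rl * cY ≤ B := by
      have : 2 * B / 2 ^ rl * cY = B * (2 * cY / 2 ^ rl) := by ring
      rw [this]
      exact mul_le_of_le_one_right hB ((div_le_one (by positivity)).2 hy)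
    have q2 : 2 * B / 2 ^ M * cg ≤ B := by
      have : 2 * B / 2 ^ M * cg = B * (2 * cg / 2 ^ M) := by ring
      rw [this]
      exact mul_le_of_le_one_right hB ((div_le_one (by positivity)).2 hg)
    refine mul_le_mul_of_nonneg_left ?_ (by positivity)
    calc _ ≤ (c.nb : ℝ) * (3 * h + 2) * (B + B) + h * B := by gcongr
      _ = _ := by ring
  · intro i x y _ _ hi
    rcases hi with hi | hi
    · exact absurd (fun j' hj' => absurd hj' (Nat.not_lt_zero _)) hi
    · exact absurd hi (Nat.not_lt_zero _)
  · intro r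
    rw [card_bitStr]
    exact law_truncate ok.hlM (fun y => truncate M (c.ybar c.i0 y)) hB hmM r

end SSRAnalysis2

set_option linter.unusedSectionVars false
section Prephase
open Classical

/-- The value `R^{j+1}_{Ind}` of a row of `SSR`. -/
def ssrV {n rl ℓ M : ℕ} (Extq : BitStr M → BitStr ℓ → BitStr ℓ)
    (Extw : BitStr n → BitStr ℓ → BitStr ℓ) (Ext : BitStr rl → BitStr ℓ → BitStr M)
    (x : BitStr n) (w : BitStr rl) (ind : ℕ → ℕ) (j : ℕ) : BitStr ℓ :=
  laR Extq Extw x (ssrY Extq Extw Ext x w ind j)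
      (truncate ℓ (ssrY Extq Extw Ext x w ind j)) (ind j)

theorem prephase {n M ℓ rl : ℕ} {ι O : Type*} [Fintype ι] [DecidableEq ι] [Fintype O]
    (Extq : BitStr M → BitStr ℓ → BitStr ℓ)
    (Extw : BitStr n → BitStr ℓ → BitStr ℓ) (Ext : BitStr rl → BitStr ℓ → BitStr M)
    (Ext₂ : BitStr n → BitStr ℓ → BitStr ℓ) (Ext₃ : BitStr n → BitStr ℓ → BitStr rl)
    (i0 : ι) (ind : ι → ℕ → ℕ) (nb : ℕ) (s : BitStr n → ι → BitStr ℓ)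
    (φ : (ι → BitStr ℓ) → O) (hφ : ∀ v v', (∀ i, i ≠ i0 → v i = v' i) → φ v = φ v')
    {ε τ α β0 T3 : ℝ} (ε0 : 0 ≤ ε) (hT3 : 0 ≤ T3)
    (hlM : ℓ ≤ M) (hMr : M ≤ rl)
    (hq : GoodExt Extq (2 ^ (11 * ℓ)) ε) (hw : GoodExt Extw (2 ^ (11 * ℓ)) ε)
    (he : GoodExt Ext (2 ^ (2 * M + ℓ)) ε) (h3 : GoodExt Ext₃ T3 ε)
    (hle : ∀ j < nb, ∀ i, (∀ j' < j, ind i j' = ind i0 j') → ind i j ≤ ind i0 j)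
    (hne : ∀ i, i ≠ i0 → ∃ j < nb, ind i j ≠ ind i0 j) (hnb : 0 < nb)
    {h : ℕ} (hh : ∀ j, ind i0 j < h)
    (hg : 2 * ((Fintype.card (ι → BitStr ℓ) : ℝ) ^ h * 2 ^ (11 * ℓ)) ≤ 2 ^ M)
    (hy : 2 * (((Fintype.card (ι → BitStr ℓ) : ℝ) ^ h * (Fintype.card (ι → BitStr M) : ℝ)) ^ nb
        * 2 ^ (2 * M + ℓ)) ≤ 2 ^ rl)
    {pX q : BitStr n → ℝ} (pX0 : ∀ x, 0 ≤ pX x) (pX1 : mass pX = 1) (pXα : ∀ x, pX x ≤ α)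
    (hα : (Fintype.card (ι → BitStr ℓ) : ℝ) * (α *
      (((Fintype.card (ι → BitStr ℓ) : ℝ) ^ (h + 1)) ^ nb * 2 ^ (11 * ℓ))) ≤ 1)
    (q0 : ∀ y, 0 ≤ q y) (qβ : ∀ y, q y ≤ β0)
    (hgood : ∀ y, q y ≠ 0 → exc pX (fun x => Ext₂ x (s y i0)) ≤ τ) :
    defect pX q
      (fun x y => φ (fun i => ssrV Extq Extw Ext x (Ext₃ y (Ext₂ x (s y i))) (ind i) (nb - 1)))
      (fun x y => ssrV Extq Extw Ext x (Ext₃ y (Ext₂ x (s y i0))) (ind i0) (nb - 1)) ≤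
      (2 * τ + 4 * ε + 8 * ε * (2 * (nb * (3 * h + 2)) + h)) * mass q +
        4 * ε * ((Fintype.card (ι → BitStr ℓ) : ℝ) * (T3 * β0)) := by
  set o : BitStr n → BitStr n → O :=
    (fun x y => φ (fun i => ssrV Extq Extw Ext x (Ext₃ y (Ext₂ x (s y i))) (ind i) (nb - 1)))
    with ho
  set z : BitStr n → BitStr n → BitStr ℓ :=
    (fun x y => ssrV Extq Extw Ext x (Ext₃ y (Ext₂ x (s y i0))) (ind i0) (nb - 1)) with hz
  set Λ : ℝ := (Fintype.card (ι → BitStr ℓ) : ℝ) with hΛ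
  have hΛ0 : 0 ≤ Λ := by positivity
  set K : ℝ := (2 * (nb * (3 * h + 2)) + h) with hK
  have hK0 : 0 ≤ K := by positivity
  have hβ0 : 0 ≤ β0 := (q0 (fun _ => false)).trans (qβ _)
  rw [defect_split_Y pX q o z s]
  have key : ∀ e : ι → BitStr ℓ, defect pX (restr q (fun y => s y = e)) o z ≤
      (2 * τ + 4 * ε + 8 * ε * K) * mass (restr q (fun y => s y = e)) + 4 * ε * (T3 * β0) := by
    intro e
    set qe := restr q (fun y => s y = e) with hqe
    have qe0 : ∀ y, 0 ≤ qe y := restr_nonneg q0 _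
    have qeβ : ∀ y, qe y ≤ β0 := fun y => (restr_le q0 _ y).trans (qβ y)
    have mq := mass_nonneg qe0
    by_cases hsupp : ∃ y, qe y ≠ 0
    swap
    · push Not at hsupp
      have hm : mass qe = 0 := Finset.sum_eq_zero fun y _ => hsupp y
      have := defect_le_mass pX0 qe0 o z
      rw [hm, mul_zero] at this ⊢
      have : 0 ≤ 4 * ε * (T3 * β0) := by positivity
      linarith
    obtain ⟨y1, hy1⟩ := hsupp
    have hτ : exc pX (fun x => Ext₂ x (e i0)) ≤ τ := by
      have := hgood y1 (restr_ne hy1).2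
      rwa [(restr_ne hy1).1] at this
    have hl := defect_light_X pX0 qe0 o z (fun x => Ext₂ x (e i0))
    set a := lightR pX (fun x => Ext₂ x (e i0)) with hadef
    have a0 : ∀ x, 0 ≤ a x := lightR_nonneg pX0 _
    have ma : mass a ≤ 1 := by rw [← pX1]; exact mass_mono (lightR_le pX0 _)
    have hlaw : ∀ r, law a (fun x => (fun (x : BitStr n) (i : ι) => Ext₂ x (e i)) x i0) r
        ≤ 2 * 1 / Fintype.card (BitStr ℓ) := by
      intro r
      rw [← pX1]
      exact law_lightR pX0 _ r
    have hstep := step_XY i0 h3 a0 qe0 o z (fun y => y)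
      (κ := β0) (fun u => by rw [law_id]; exact qeβ u)
      (ρ := fun x i => Ext₂ x (e i)) zero_le_one hlaw
    have hc : ∀ c : ι → BitStr ℓ,
        defect (restr a (fun x => (fun i => Ext₂ x (e i)) = c))
          (lightR qe (fun y => Ext₃ y (c i0))) o z ≤
        4 * ε * (mass (restr a (fun x => (fun i => Ext₂ x (e i)) = c)) +
          α * ((Λ ^ (h + 1)) ^ nb * 2 ^ (11 * ℓ))) * (K * mass qe) := by
      intro c
      let cx : Ctx n M ℓ rl ι (BitStr n) O :=
        { Extq := Extq, Extw := Extw, Ext := Ext, ind := ind, i0 := i0, nb := nb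
          ybar := fun i y => Ext₃ y (c i)
          o := fun x y => φ (fun i => ssrV Extq Extw Ext x (Ext₃ y (c i)) (ind i) (nb - 1)) }
      have ok : cx.OK ε :=
        { ε0 := ε0, hlM := hlM, hMr := hMr, hq := hq, hw := hw, he := he, hle := hle
          hne := hne, hnb := hnb
          hO := fun x y x' y' hv => hφ _ _ hv }
      have hcl := Ctx.claim ok hh hg hy
        (a := restr a (fun x => (fun i => Ext₂ x (e i)) = c))
        (b := lightR qe (fun y => Ext₃ y (c i0)))
        (restr_nonneg a0 _) (lightR_nonneg qe0 _) (α := α) (B := mass qe)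
        (fun x => (restr_le a0 _ x).trans ((lightR_le pX0 _ x).trans (pXα x)))
        (mass_mono (lightR_le qe0 _))
        (fun u => by
          have := law_lightR qe0 (fun y => Ext₃ y (c i0)) u
          rwa [card_bitStr] at this)
      refine le_trans (le_of_eq ?_) hcl
      have hW : ∀ x y, restr a (fun x => (fun i => Ext₂ x (e i)) = c) x ≠ 0 →
          lightR qe (fun y => Ext₃ y (c i0)) y ≠ 0 → ∀ i, Ext₂ x (s y i) = c i := by
        intro x y hx hy i
        have h1 := (restr_ne (restr_ne hy).2).1
        rw [h1]
        exact congrFun (restr_ne hx).1 i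
      refine defect_congr (fun x y hx hy => ?_) (fun x y hx hy => ?_)
      · simp only [ho, hW x y hx hy, cx]
      · simp only [hz, hW x y hx hy]
        rfl
    have hsum := Finset.sum_le_sum fun (c : ι → BitStr ℓ) (_ : c ∈ univ) => hc c
    have hmm : ∑ c, mass (restr a (fun x => (fun i => Ext₂ x (e i)) = c)) = mass a :=
      sum_mass_restr a (fun x i => Ext₂ x (e i))
    rw [← Finset.sum_mul, ← Finset.mul_sum, Finset.sum_add_distrib, hmm,
      Finset.sum_const, nsmul_eq_mul, Finset.card_univ] at hsum
    have e1 : 4 * ε * (mass a + Λ * (α * ((Λ ^ (h + 1)) ^ nb * 2 ^ (11 * ℓ)))) * (K * mass qe)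
        ≤ 4 * ε * (1 + 1) * (K * mass qe) := by gcongr
    have e2 : mass qe * (2 * exc pX (fun x => Ext₂ x (e i0))) ≤ mass qe * (2 * τ) := by gcongr
    have e3 : (2 * τ + 4 * ε + 8 * ε * K) * mass qe + 4 * ε * (T3 * β0)
      = mass qe * (2 * τ) + 4 * ε * 1 * (mass qe + T3 * β0) + 4 * ε * (1 + 1) * (K * mass qe) := by
      ring
    linarith
  have hsum := Finset.sum_le_sum fun (e : ι → BitStr ℓ) (_ : e ∈ univ) => key e
  have hmm : ∑ e, mass (restr q (fun y => s y = e)) = mass q := sum_mass_restr q s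
  rw [Finset.sum_add_distrib, ← Finset.mul_sum, hmm,
      Finset.sum_const, nsmul_eq_mul, Finset.card_univ] at hsum
  refine hsum.trans (le_of_eq ?_)
  ring

end Prephase

set_option linter.unusedSectionVars false
section Digits

theorem SR_eq {n rl ℓ M d : ℕ} (l b : ℕ)
    (Ext₁ : BitStr n → BitStr d → BitStr ℓ) (Ext₂ : BitStr n → BitStr ℓ → BitStr ℓ)
    (Ext₃ : BitStr n → BitStr ℓ → BitStr rl)
    (Extq : BitStr M → BitStr ℓ → BitStr ℓ) (Extw : BitStr n → BitStr ℓ → BitStr ℓ)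
    (Ext : BitStr rl → BitStr ℓ → BitStr M)
    (x y : BitStr n) (i : Fin (2 ^ d)) :
    SR l b Ext₁ Ext₂ Ext₃ Extq Extw Ext x y i =
      ssrV Extq Extw Ext x (Ext₃ y (Ext₂ x (Ext₁ y (natToBits d (i : ℕ)))))
        (blockVal d l b (i : ℕ)) (b - 1) := by
  have key : ∀ w : BitStr rl, ∀ j : ℕ, (Nat.rec (truncate M w)
        (fun j' prev =>
          Ext w (laR Extq Extw x prev (truncate ℓ prev) (blockVal d l b (i : ℕ) j')))
        j : BitStr M) = ssrY Extq Extw Ext x w (blockVal d l b (i : ℕ)) j := by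
    intro w j
    induction j with
    | zero => rfl
    | succ j ih => simp only [ssrY]; rw [← ih]
  unfold SR SSR ssrV
  simp only [key]

theorem blockVal_lt (d l b v j : ℕ) : blockVal d l b v j < 2 ^ l :=
  Nat.mod_lt _ (by positivity)

theorem pfxSucc (d l b v j : ℕ) (hj : j < b) :
    v * 2 ^ (b * l - d) / 2 ^ ((b - (j + 1)) * l) =
      (v * 2 ^ (b * l - d) / 2 ^ ((b - j) * l)) * 2 ^ l + blockVal d l b v j := by
  have e : (b - j) * l = (b - (j + 1)) * l + l := by
    obtain ⟨m, rfl⟩ := Nat.exists_eq_add_of_lt hj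
    have h1 : j + m + 1 - j = m + 1 := by omega
    have h2 : j + m + 1 - (j + 1) = m := by omega
    rw [h1, h2]; ring
  have e2 : b - 1 - j = b - (j + 1) := by omega
  unfold blockVal
  rw [e, e2, pow_add, ← Nat.div_div_eq_div_mul, mul_comm _ (2 ^ l)]
  exact (Nat.div_add_mod _ _).symm

theorem pfxEq (d l b v v' : ℕ) (hv : v < 2 ^ d) (hv' : v' < 2 ^ d) (hd : d ≤ b * l) (j : ℕ)
    (hj : j ≤ b) (h : ∀ j' < j, blockVal d l b v' j' = blockVal d l b v j') :
    v' * 2 ^ (b * l - d) / 2 ^ ((b - j) * l) = v * 2 ^ (b * l - d) / 2 ^ ((b - j) * l) := by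
  induction j with
  | zero =>
    have key : ∀ w < 2 ^ d, w * 2 ^ (b * l - d) < 2 ^ (b * l) := by
      intro w hw
      calc w * 2 ^ (b * l - d) < 2 ^ d * 2 ^ (b * l - d) :=
            Nat.mul_lt_mul_of_pos_right hw (by positivity)
        _ = 2 ^ (b * l) := by rw [← pow_add]; congr 1; omega
    rw [Nat.sub_zero, Nat.div_eq_of_lt (key v hv), Nat.div_eq_of_lt (key v' hv')]
  | succ j ih =>
    rw [pfxSucc _ _ _ _ _ (by omega), pfxSucc _ _ _ _ _ (by omega),
      ih (by omega) (fun j' hj' => h j' (by omega)), h j (by omega)]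

theorem digit_le (d l b v v' : ℕ) (hv : v < 2 ^ d) (hvv : v' ≤ v) (hd : d ≤ b * l) (j : ℕ)
    (hj : j < b) (h : ∀ j' < j, blockVal d l b v' j' = blockVal d l b v j') :
    blockVal d l b v' j ≤ blockVal d l b v j := by
  have h1 := pfxEq d l b v v' hv (lt_of_le_of_lt hvv hv) hd j hj.le h
  have h2 := pfxSucc d l b v j hj
  have h3 := pfxSucc d l b v' j hj
  have h4 : v' * 2 ^ (b * l - d) / 2 ^ ((b - (j + 1)) * l) ≤
      v * 2 ^ (b * l - d) / 2 ^ ((b - (j + 1)) * l) :=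
    Nat.div_le_div_right (Nat.mul_le_mul_right _ hvv)
  rw [h1] at h3
  omega

theorem digit_ne (d l b v v' : ℕ) (hv : v < 2 ^ d) (hv' : v' < 2 ^ d) (hne : v' ≠ v)
    (hd : d ≤ b * l) : ∃ j < b, blockVal d l b v' j ≠ blockVal d l b v j := by
  by_contra hcon
  push Not at hcon
  have := pfxEq d l b v v' hv hv' hd b le_rfl hcon
  simp at this
  exact hne this

theorem natToBits_bij (d : ℕ) :
    Function.Bijective (fun i : Fin (2 ^ d) => natToBits d (i : ℕ)) := by
  rw [Fintype.bijective_iff_injective_and_card]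
  refine ⟨?_, by simp [BitStr]⟩
  intro i i' h
  apply Fin.ext
  apply Nat.eq_of_testBit_eq
  intro j
  by_cases hj : j < d
  · exact congrFun h ⟨j, hj⟩
  · have : 2 ^ d ≤ 2 ^ j := Nat.pow_le_pow_right (by norm_num) (by omega)
    rw [Nat.testBit_eq_false_of_lt (lt_of_lt_of_le i.2 this),
      Nat.testBit_eq_false_of_lt (lt_of_lt_of_le i'.2 this)]

end Digits

section Hybrid
open Classical

theorem exc_equiv {X V V' : Type*} [Fintype X] [Fintype V] [Fintype V'] (p : X → ℝ) (f : X → V)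
    (Φ : V ≃ V') : exc p (fun x => Φ (f x)) = exc p f := by
  unfold exc
  rw [← Equiv.sum_comp Φ]
  refine Finset.sum_congr rfl fun v _ => ?_
  rw [Fintype.card_congr Φ]
  congr 2
  unfold law
  refine Finset.sum_congr rfl fun x _ => ?_
  simp

theorem hybrid_step {X V : Type*} [Fintype X] [Fintype V] [Nonempty V] {m : ℕ} (p : X → ℝ)
    (f : X → Fin (m + 1) → V) :
    exc p f ≤ (∑ u : Fin m → V, ∑ w, max (law p (fun x => ((fun i : Fin m => f x i.castSucc),
        f x (Fin.last m))) (u, w) - law p (fun x (i : Fin m) => f x i.castSucc) u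
          / Fintype.card V) 0) + exc p (fun x (i : Fin m) => f x i.castSucc) := by
  have h1 : exc p f = exc p (fun x => ((fun i : Fin m => f x i.castSucc), f x (Fin.last m))) := by
    let Φ : (Fin (m + 1) → V) ≃ (Fin m → V) × V :=
      { toFun := fun v => (fun i => v i.castSucc, v (Fin.last m))
        invFun := fun w => Fin.snoc (α := fun _ => V) w.1 w.2
        left_inv := fun v => by
          funext i
          refine Fin.lastCases ?_ (fun i => ?_) i <;> simp
        right_inv := fun w => by ext <;> simp }
    exact (exc_equiv p f Φ).symm
  rw [h1]
  unfold exc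
  rw [Fintype.sum_prod_type]
  have hc : (0 : ℝ) < Fintype.card V := by exact_mod_cast Fintype.card_pos
  have h2 : ∀ u : Fin m → V, max (law p (fun x (i : Fin m) => f x i.castSucc) u
      - mass p / Fintype.card (Fin m → V)) 0 = ∑ w : V,
      max (law p (fun x (i : Fin m) => f x i.castSucc) u / Fintype.card V
      - mass p / Fintype.card ((Fin m → V) × V)) 0 := by
    intro u
    rw [Finset.sum_const, nsmul_eq_mul, Finset.card_univ, mul_max_of_nonneg _ _ hc.le]
    congr 1
    · rw [Fintype.card_prod]
      push_cast
      field_simp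
    · simp
  simp_rw [h2]
  rw [← Finset.sum_add_distrib]
  refine Finset.sum_le_sum fun u _ => ?_
  rw [← Finset.sum_add_distrib]
  refine Finset.sum_le_sum fun w _ => ?_
  refine le_trans (le_of_eq ?_) (posPart_add_le' _ _)
  congr 1
  ring

theorem hybrid {X Y V : Type*} [Fintype X] [Fintype Y] [Fintype V] [Nonempty V] {p : X → ℝ}
    {q : Y → ℝ} (q0 : ∀ y, 0 ≤ q y) {h : ℕ} (f : X → Y → ℕ → V) (D : ℝ)
    (hD : ∀ m < h, defect p q (fun x y (i : Fin m) => f x y i) (fun x y => f x y m) ≤ D) :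
    ∑ y, q y * exc p (fun x (i : Fin h) => f x y i) ≤ h * D := by
  induction h with
  | zero =>
    have : ∀ y, exc p (fun x (i : Fin 0) => f x y i) = 0 := by
      intro y
      unfold exc
      refine Finset.sum_eq_zero fun v _ => ?_
      have h1 : law p (fun x (i : Fin 0) => f x y i) v = mass p := by
        unfold law mass
        refine Finset.sum_congr rfl fun x _ => if_pos (Subsingleton.elim _ _)
      rw [h1]; simp
    simp [this]
  | succ m ih =>
    have h1 := ih fun m' hm' => hD m' (by omega)
    have h2 := hD m (by omega)
    calc _ ≤ ∑ y, (q y * (∑ u : Fin m → V, ∑ w, max (law p (fun x =>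
            ((fun i : Fin m => f x y i), f x y m)) (u, w) -
              law p (fun x (i : Fin m) => f x y i) u / Fintype.card V) 0) +
            q y * exc p (fun x (i : Fin m) => f x y i)) := by
          refine Finset.sum_le_sum fun y _ => ?_
          rw [← mul_add]
          refine mul_le_mul_of_nonneg_left ?_ (q0 y)
          have := hybrid_step p (fun x (i : Fin (m + 1)) => f x y i)
          simpa only [Fin.val_castSucc, Fin.val_last] using this
      _ = defect p q (fun x y (i : Fin m) => f x y i) (fun x y => f x y m) +
          ∑ y, q y * exc p (fun x (i : Fin m) => f x y i) := by
          rw [Finset.sum_add_distrib]; rfl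
      _ ≤ D + m * D := add_le_add h2 h1
      _ = _ := by push_cast; ring

end Hybrid

set_option linter.unusedSectionVars false
section Rows
open Classical

theorem row_bound {n M ℓ rl d l b h k : ℕ}
    (Ext₁ : BitStr n → BitStr d → BitStr ℓ)
    (Extq : BitStr M → BitStr ℓ → BitStr ℓ)
    (Extw : BitStr n → BitStr ℓ → BitStr ℓ) (Ext : BitStr rl → BitStr ℓ → BitStr M)
    (Ext₂ : BitStr n → BitStr ℓ → BitStr ℓ) (Ext₃ : BitStr n → BitStr ℓ → BitStr rl)
    {ε τ : ℝ} (ε0 : 0 ≤ ε)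
    (hh : h = 2 ^ l) (hd : d ≤ b * l) (hb : 0 < b)
    (hlM : ℓ ≤ M) (hMr : M ≤ rl)
    (N1 : 1 + ℓ * h * h + 11 * ℓ ≤ M)
    (N2 : 1 + (ℓ * h * h + M * h) * b + (2 * M + ℓ) ≤ rl)
    (N3 : ℓ * h + ℓ * h * (h + 1) * b + 11 * ℓ ≤ 2 * k)
    (hq : GoodExt Extq (2 ^ (11 * ℓ)) ε) (hw : GoodExt Extw (2 ^ (11 * ℓ)) ε)
    (he : GoodExt Ext (2 ^ (2 * M + ℓ)) ε) (h3 : GoodExt Ext₃ (2 ^ (k + ℓ)) ε)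
    {pX q : BitStr n → ℝ} (pX0 : ∀ x, 0 ≤ pX x) (pX1 : mass pX = 1)
    (pXα : ∀ x, pX x ≤ ((2 : ℝ) ^ (2 * k))⁻¹)
    (q0 : ∀ y, 0 ≤ q y) (qβ : ∀ y, q y ≤ ((2 : ℝ) ^ (2 * k))⁻¹)
    (v : ℕ → ℕ) (hv : ∀ i < h, v i < 2 ^ d) (hvm : ∀ i j, i < j → j < h → v i < v j)
    (hgood : ∀ y, q y ≠ 0 → ∀ i < h,
      exc pX (fun x => Ext₂ x (Ext₁ y (natToBits d (v i)))) ≤ τ) :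
    ∑ y, q y * exc pX (fun x (i : Fin h) =>
      ssrV Extq Extw Ext x (Ext₃ y (Ext₂ x (Ext₁ y (natToBits d (v i)))))
        (blockVal d l b (v i)) (b - 1)) ≤
      h * ((2 * τ + 4 * ε + 8 * ε * (2 * (b * (3 * h + 2)) + h)) * mass q +
        4 * ε * ((2 : ℝ) ^ (ℓ * h) * (2 ^ (k + ℓ) * ((2 : ℝ) ^ (2 * k))⁻¹))) := by
  refine hybrid q0 (fun x y i => ssrV Extq Extw Ext x
    (Ext₃ y (Ext₂ x (Ext₁ y (natToBits d (v i))))) (blockVal d l b (v i)) (b - 1)) _ ?_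
  intro m hm
  have hcard : ∀ e : ℕ, (Fintype.card (Fin (m + 1) → BitStr e) : ℝ) = 2 ^ (e * (m + 1)) := by
    intro e
    rw [Fintype.card_fun, Fintype.card_fin]
    push_cast
    rw [card_bitStr, ← pow_mul]
  have hcle : ∀ e : ℕ, (Fintype.card (Fin (m + 1) → BitStr e) : ℝ) ≤ 2 ^ (e * h) := by
    intro e
    rw [hcard]
    exact pow_le_pow_right₀ (by norm_num) (Nat.mul_le_mul_left _ (by omega))
  have := prephase Extq Extw Ext Ext₂ Ext₃ (Fin.last m)
    (fun i : Fin (m + 1) => blockVal d l b (v i)) b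
    (fun y (i : Fin (m + 1)) => Ext₁ y (natToBits d (v i)))
    (fun w (i : Fin m) => w i.castSucc)
    (fun w w' hww => by
      funext i
      exact hww _ (Fin.castSucc_lt_last i).ne)
    (τ := τ) (α := ((2 : ℝ) ^ (2 * k))⁻¹) (β0 := ((2 : ℝ) ^ (2 * k))⁻¹)
    ε0 (by positivity) hlM hMr hq hw he h3
    (fun j hj i hpre => by
      refine digit_le d l b _ _ (hv _ (by simpa using hm)) ?_ hd j hj hpre
      rcases Nat.lt_or_ge (i : ℕ) m with hi | hi
      · exact (hvm _ _ (by simpa using hi) (by simpa using hm)).le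
      · have : i = Fin.last m := Fin.ext (by simp; omega)
        rw [this])
    (fun i hi => by
      have hi' : (i : ℕ) < m := by
        have := i.2
        have h2 : (i : ℕ) ≠ m := fun h' => hi (Fin.ext (by simpa using h'))
        omega
      refine digit_ne d l b _ _ (hv _ (by simpa using hm)) (hv _ (by omega)) ?_ hd
      exact (hvm _ _ (by simpa using hi') (by simpa using hm)).ne)
    hb (h := h) (fun j => by
      have := blockVal_lt d l b (v ((Fin.last m : Fin (m+1)) : ℕ)) j
      simpa only [hh] using this)
    (by
      calc (2 : ℝ) * ((Fintype.card (Fin (m + 1) → BitStr ℓ) : ℝ) ^ h * 2 ^ (11 * ℓ))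
          ≤ 2 * ((2 ^ (ℓ * h)) ^ h * 2 ^ (11 * ℓ)) := by gcongr; exact hcle ℓ
        _ = 2 ^ (1 + ℓ * h * h + 11 * ℓ) := by rw [pow_add, pow_add, ← pow_mul]; ring
        _ ≤ _ := pow_le_pow_right₀ (by norm_num) N1)
    (by
      calc (2 : ℝ) * (((Fintype.card (Fin (m + 1) → BitStr ℓ) : ℝ) ^ h *
            (Fintype.card (Fin (m + 1) → BitStr M) : ℝ)) ^ b * 2 ^ (2 * M + ℓ))
          ≤ 2 * (((2 ^ (ℓ * h)) ^ h * 2 ^ (M * h)) ^ b * 2 ^ (2 * M + ℓ)) := by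
            gcongr
            · exact hcle ℓ
            · exact hcle M
        _ = 2 ^ (1 + (ℓ * h * h + M * h) * b + (2 * M + ℓ)) := by
            rw [← pow_mul, ← pow_add, ← pow_mul, pow_add, pow_add]; ring
        _ ≤ _ := pow_le_pow_right₀ (by norm_num) N2)
    pX0 pX1 pXα
    (by
      calc (Fintype.card (Fin (m + 1) → BitStr ℓ) : ℝ) * (((2 : ℝ) ^ (2 * k))⁻¹ *
            (((Fintype.card (Fin (m + 1) → BitStr ℓ) : ℝ) ^ (h + 1)) ^ b * 2 ^ (11 * ℓ)))
          ≤ 2 ^ (ℓ * h) * (((2 : ℝ) ^ (2 * k))⁻¹ *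
            (((2 ^ (ℓ * h)) ^ (h + 1)) ^ b * 2 ^ (11 * ℓ))) := by
            gcongr
            · exact hcle ℓ
            · exact hcle ℓ
        _ = 2 ^ (ℓ * h + ℓ * h * (h + 1) * b + 11 * ℓ) * ((2 : ℝ) ^ (2 * k))⁻¹ := by
            rw [← pow_mul, ← pow_mul, pow_add, pow_add]; ring
        _ ≤ 2 ^ (2 * k) * ((2 : ℝ) ^ (2 * k))⁻¹ := by
            gcongr
            norm_num
        _ = 1 := mul_inv_cancel₀ (by positivity))
    q0 qβ
    (fun y hy => hgood y hy m hm)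
  refine this.trans ?_
  have := hcle ℓ
  gcongr

theorem bad_seed {n d ℓ k : ℕ} {Ext₁ : BitStr n → BitStr d → BitStr ℓ}
    (hE : IsSeededExtractor Ext₁ (k : ℝ) (1 / 4)) {pY : BitStr n → ℝ} (pY0 : ∀ y, 0 ≤ pY y)
    (pYβ : ∀ y, pY y ≤ ((2 : ℝ) ^ (2 * k))⁻¹) {τ : ℝ} (hτ : τ < 1 / 12)
    (Bs : Finset (BitStr ℓ)) (hBs : (Bs.card : ℝ) ≤ 2 ^ ℓ * τ) :
    mass (restr pY (fun y => ((univ.filter fun i : Fin (2 ^ d) =>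
      Ext₁ y (natToBits d i) ∉ Bs).card : ℝ) < 2 / 3 * (2 ^ d : ℕ))) ≤ ((2 : ℝ) ^ k)⁻¹ := by
  by_contra hcon
  push Not at hcon
  set E : BitStr n → Prop := fun y => ((univ.filter fun i : Fin (2 ^ d) =>
      Ext₁ y (natToBits d i) ∉ Bs).card : ℝ) < 2 / 3 * (2 ^ d : ℕ) with hEd
  set q := restr pY E with hq
  have q0 : ∀ y, 0 ≤ q y := restr_nonneg pY0 _
  have hpos : 0 < mass q := lt_trans (by positivity) hcon
  have hsrc := hE (fun y => (mass q)⁻¹ * q y)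
      ⟨fun u => mul_nonneg (by positivity) (q0 u), by
        have := mass_smul (mass q)⁻¹ q
        unfold mass at this ⊢
        rw [this]; exact inv_mul_cancel₀ hpos.ne'⟩
      (fun u => by
        rw [Real.rpow_neg (by norm_num), Real.rpow_natCast]
        rw [inv_mul_le_iff₀ hpos]
        calc q u ≤ ((2 : ℝ) ^ (2 * k))⁻¹ := (restr_le pY0 _ u).trans (pYβ u)
          _ = ((2 : ℝ) ^ k)⁻¹ * ((2 : ℝ) ^ k)⁻¹ := by rw [two_mul, pow_add, mul_inv]
          _ ≤ mass q * ((2 : ℝ) ^ k)⁻¹ := by gcongr)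
  have h1 := (le_abs_self _).trans ((abs_le_statDist _ _ Bs).trans hsrc)
  have hu : ∑ a ∈ Bs, unif (BitStr ℓ) a ≤ τ := by
    unfold unif
    rw [Finset.sum_const, nsmul_eq_mul, card_bitStr, ← div_eq_mul_inv,
      div_le_iff₀ (by positivity)]
    linarith
  have hlow : 1 / 3 ≤ ∑ a ∈ Bs, ∑ x : BitStr n, ∑ r : BitStr d,
      if Ext₁ x r = a then (mass q)⁻¹ * q x * unif (BitStr d) r else 0 := by
    rw [Finset.sum_comm]
    have hx : ∀ x : BitStr n, (mass q)⁻¹ * q x * (1 / 3) ≤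
        ∑ a ∈ Bs, ∑ r : BitStr d,
          if Ext₁ x r = a then (mass q)⁻¹ * q x * unif (BitStr d) r else 0 := by
      intro x
      rw [Finset.sum_comm]
      by_cases hqx : q x = 0
      · simp [hqx]
      have hEx : E x := (restr_ne hqx).1
      have hin : ∀ r : BitStr d, (∑ a ∈ Bs, if Ext₁ x r = a then
          (mass q)⁻¹ * q x * unif (BitStr d) r else 0)
          = ((mass q)⁻¹ * q x * (2 ^ d)⁻¹) * (if Ext₁ x r ∈ Bs then 1 else 0) := by
        intro r
        rw [Finset.sum_ite_eq]
        unfold unif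
        rw [card_bitStr]
        split_ifs <;> simp
      simp_rw [hin]
      rw [← Finset.mul_sum]
      have hbij : ∑ r : BitStr d, (if Ext₁ x r ∈ Bs then (1 : ℝ) else 0)
          = ∑ i : Fin (2 ^ d), if Ext₁ x (natToBits d i) ∈ Bs then (1 : ℝ) else 0 :=
        ((natToBits_bij d).sum_comp (fun r => if Ext₁ x r ∈ Bs then (1 : ℝ) else 0)).symm
      rw [hbij]
      have hsplit : (∑ i : Fin (2 ^ d), if Ext₁ x (natToBits d i) ∈ Bs then (1 : ℝ) else 0)
          + ((univ.filter fun i : Fin (2 ^ d) => Ext₁ x (natToBits d i) ∉ Bs).card : ℝ)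
          = 2 ^ d := by
        rw [Finset.card_filter]
        push_cast
        rw [← Finset.sum_add_distrib]
        rw [Finset.sum_congr rfl (g := fun _ => (1 : ℝ))
          (fun i _ => by by_cases hh : Ext₁ x (natToBits d i) ∈ Bs <;> simp [hh])]
        simp
      have hge : (1 / 3 : ℝ) * 2 ^ d ≤
          ∑ i : Fin (2 ^ d), if Ext₁ x (natToBits d i) ∈ Bs then (1 : ℝ) else 0 := by
        have : ((univ.filter fun i : Fin (2 ^ d) =>
          Ext₁ x (natToBits d i) ∉ Bs).card : ℝ) < 2 / 3 * (2 ^ d : ℕ) := hEx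
        push_cast at this
        linarith
      have hcoef : 0 ≤ (mass q)⁻¹ * q x * ((2 : ℝ) ^ d)⁻¹ :=
        mul_nonneg (mul_nonneg (by positivity) (q0 x)) (by positivity)
      refine le_trans (le_of_eq ?_) (mul_le_mul_of_nonneg_left hge hcoef)
      field_simp
    calc (1 / 3 : ℝ) = ∑ x, (mass q)⁻¹ * q x * (1 / 3) := by
          rw [← Finset.sum_mul, ← Finset.mul_sum]
          change _ = (mass q)⁻¹ * mass q * _
          rw [inv_mul_cancel₀ hpos.ne', one_mul]
      _ ≤ _ := Finset.sum_le_sum fun x _ => hx x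
  linarith

end Rows

set_option linter.unusedSectionVars false
section Final
open Classical

theorem nat_params {k ℓ l h b d : ℕ} (hℓ : 1 ≤ ℓ) (hl : 0 < l) (hh : h = 2 ^ l)
    (hd : d ≤ b * l)
    (hk : 2 * (b * h + 2) * (h ^ 2 + 12) * ℓ ≤ k) :
    ℓ ≤ (h ^ 2 + 12) * ℓ ∧ (h ^ 2 + 12) * ℓ ≤ 9 * k / 10 ∧
    1 + ℓ * h * h + 11 * ℓ ≤ (h ^ 2 + 12) * ℓ ∧
    1 + (ℓ * h * h + (h ^ 2 + 12) * ℓ * h) * b + (2 * ((h ^ 2 + 12) * ℓ) + ℓ) ≤ 9 * k / 10 ∧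
    ℓ * h + ℓ * h * (h + 1) * b + 11 * ℓ ≤ 2 * k ∧
    d * h + (h + 1) * ℓ + ℓ + 1 ≤ k ∧ 64 ≤ k ∧
    h * (6 + 8 * (2 * (b * (3 * h + 2)) + h)) ≤ 16 * k := by
  have h2 : 2 ≤ h := by
    rw [hh]; calc 2 = 2 ^ 1 := rfl
      _ ≤ 2 ^ l := Nat.pow_le_pow_right (by norm_num) hl
  have hlh : l ≤ h := by rw [hh]; exact (Nat.lt_two_pow_self).le
  have hdh : d ≤ b * h := hd.trans (Nat.mul_le_mul_left _ hlh)
  obtain ⟨M, hM⟩ : ∃ M, M = (h ^ 2 + 12) * ℓ := ⟨_, rfl⟩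
  have hk' : 2 * (b * h * M) + 4 * M ≤ k := by
    calc _ = 2 * (b * h + 2) * (h ^ 2 + 12) * ℓ := by rw [hM]; ring
      _ ≤ k := hk
  rw [← hM]
  have hM2 : M = ℓ * h * h + 12 * ℓ := by rw [hM]; ring
  have e1 : ℓ * h ≤ ℓ * h * h := Nat.le_mul_of_pos_right _ (by omega)
  have e1' : ℓ * 2 ≤ ℓ * h := Nat.mul_le_mul_left _ h2
  have e1'' : ℓ * h * 2 ≤ ℓ * h * h := Nat.mul_le_mul_left _ h2
  have e2 : ℓ * h * h * b ≤ M * b := Nat.mul_le_mul_right _ (by omega)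
  have e3 : b * 2 * M ≤ b * h * M :=
    Nat.mul_le_mul_right _ (Nat.mul_le_mul_left _ h2)
  have e4 : b * 2 * M = 2 * (M * b) := by ring
  have e5 : d * h ≤ b * h * h := Nat.mul_le_mul_right _ hdh
  have hhM : h ≤ M := by
    have : 1 * h ≤ ℓ * h := Nat.mul_le_mul_right _ hℓ
    omega
  have e6 : b * h * h ≤ b * h * M := Nat.mul_le_mul_left _ hhM
  refine ⟨by omega, by omega, by omega, ?_, ?_, ?_, by omega, ?_⟩
  · have : (ℓ * h * h + M * h) * b = ℓ * h * h * b + b * h * M := by ring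
    omega
  · have e7 : ℓ * h * (h + 1) * b = ℓ * h * h * b + ℓ * h * b := by ring
    have e8 : ℓ * h * b ≤ M * b := Nat.mul_le_mul_right _ (by omega)
    omega
  · have : (h + 1) * ℓ = ℓ * h + ℓ := by ring
    omega
  · have e9 : h * (6 + 8 * (2 * (b * (3 * h + 2)) + h))
        = 6 * h + 48 * (b * h * h) + 32 * (b * h) + 8 * (h * h) := by ring
    have e10 : 1 * (h * h) ≤ ℓ * (h * h) := Nat.mul_le_mul_right _ hℓ
    have e11 : ℓ * (h * h) = ℓ * h * h := by ring
    have e12 : b * h * 2 ≤ b * h * M := Nat.mul_le_mul_left _ (by omega)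
    have e13 : b * h * (h * h) ≤ b * h * M := Nat.mul_le_mul_left _ (by omega)
    have e14 : b * h * 2 ≤ b * h * h := Nat.mul_le_mul_left _ h2
    have e15 : b * h * h * 2 ≤ b * h * h * h := Nat.mul_le_mul_left _ h2
    have e16 : b * h * (h * h) = b * h * h * h := by ring
    omega

theorem real_params {n k h K ε τ δ η : ℝ} (hη : 0 < η) (hn : n * η ≤ 1) (hkn : 2 * k ≤ n)
    (hk : 64 ≤ k) (hhk : h * (6 + 8 * K) ≤ 16 * k) (h0 : 2 ≤ h) (hK : 0 ≤ K)
    (hε : ε = η ^ 16) (hτ : τ = η ^ 8) (hδ : δ = η ^ 2) :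
    τ < 1 / 12 ∧ ε = τ * τ ∧ 0 < τ ∧ 0 < ε ∧ 0 < δ ∧
    h * (2 * τ + 4 * ε + 8 * ε * K) ≤ δ / 2 ∧ h * (4 * ε) ≤ δ / 2 := by
  have hn0 : 128 ≤ n := by linarith
  have hη1 : η ≤ 1 / 128 := by
    have : 128 * η ≤ n * η := by gcongr
    linarith
  have t0 : 0 < τ := by rw [hτ]; positivity
  have ee : ε = τ * τ := by rw [hε, hτ]; ring
  have d0 : 0 < δ := by rw [hδ]; positivity
  have t1 : τ ≤ η := by
    rw [hτ]; exact pow_le_of_le_one hη.le (by linarith) (by norm_num)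
  have et : ε ≤ τ := by rw [ee]; nlinarith
  have e0 : 0 < ε := by rw [ee]; positivity
  have key : h * (6 + 8 * K) * τ ≤ δ / 2 := by
    have a1 : h * (6 + 8 * K) * τ ≤ 16 * k * τ := by gcongr
    have a2 : 16 * k * τ ≤ 8 * n * τ := by
      apply mul_le_mul_of_nonneg_right _ t0.le; linarith
    have a3 : 8 * n * τ = 8 * (n * η) * (η ^ 5 * δ) := by rw [hτ, hδ]; ring
    have a4 : 8 * (n * η) * (η ^ 5 * δ) ≤ 8 * 1 * (η ^ 5 * δ) := by gcongr
    have a5 : η ^ 5 ≤ η := pow_le_of_le_one hη.le (by linarith) (by norm_num)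
    have a6 : η ^ 5 * δ ≤ 1 / 128 * δ := by
      apply mul_le_mul_of_nonneg_right _ d0.le; linarith
    linarith
  refine ⟨by linarith, ee, t0, e0, d0, ?_, ?_⟩
  · refine le_trans ?_ key
    rw [mul_assoc h (6 + 8 * K) τ]
    apply mul_le_mul_of_nonneg_left _ (by linarith)
    have : ε * K ≤ τ * K := by gcongr
    linarith
  · refine le_trans ?_ key
    rw [mul_assoc h (6 + 8 * K) τ]
    apply mul_le_mul_of_nonneg_left _ (by linarith)
    have : 0 ≤ K * τ := by positivity
    linarith

theorem statDist_le_exc {X ι O : Type*} [Fintype X] [Fintype ι] [DecidableEq ι] [Fintype O] [Nonempty O]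
    {p : X → ℝ} (hp : mass p = 1) (f : X → ι → O)
    [∀ zs : ι → O, DecidablePred fun x => ∀ i, f x i = zs i] :
    statDist (fun zs : ι → O => ∑ x, if ∀ i, f x i = zs i then p x else 0)
      (unif (ι → O)) ≤ exc p f := by
  have hl : (fun zs : ι → O => ∑ x, if ∀ i, f x i = zs i then p x else 0) = law p f := by
    funext zs
    unfold law
    refine Finset.sum_congr rfl fun x _ => ?_
    simp only [funext_iff]
  rw [hl]
  refine (statDist_le_posPart _ _ ?_).trans ?_
  · rw [show ∑ a, law p f a = mass p from sum_law p f, hp]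
    unfold unif
    simp
  · unfold exc unif
    rw [hp]
    simp

end Final

set_option linter.unusedSectionVars false
section Core
open Classical

theorem per_set {n k ℓ l h b d : ℕ} {ε τ δ : ℝ}
    (Ext₁ : BitStr n → BitStr d → BitStr ℓ)
    (Ext₂ : BitStr n → BitStr ℓ → BitStr ℓ)
    (Ext₃ : BitStr n → BitStr ℓ → BitStr (9 * k / 10))
    (Extq : BitStr ((h ^ 2 + 12) * ℓ) → BitStr ℓ → BitStr ℓ)
    (Extw : BitStr n → BitStr ℓ → BitStr ℓ)
    (Ext : BitStr (9 * k / 10) → BitStr ℓ → BitStr ((h ^ 2 + 12) * ℓ))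
    (ε0 : 0 < ε) (δ0 : 0 < δ) (hℓ : 1 ≤ ℓ) (hl : 0 < l) (hh : h = 2 ^ l)
    (hd : d ≤ b * l)
    (hk : 2 * (b * h + 2) * (h ^ 2 + 12) * ℓ ≤ k)
    (r1 : h * (2 * τ + 4 * ε + 8 * ε * (2 * (b * (3 * h + 2)) + h)) ≤ δ / 2)
    (r2 : h * (4 * ε) ≤ δ / 2)
    (hq : GoodExt Extq (2 ^ (11 * ℓ)) ε) (hw : GoodExt Extw (2 ^ (11 * ℓ)) ε)
    (he : GoodExt Ext (2 ^ (2 * ((h ^ 2 + 12) * ℓ) + ℓ)) ε) (h3 : GoodExt Ext₃ (2 ^ (k + ℓ)) ε)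
    {pX q : BitStr n → ℝ} (pX0 : ∀ x, 0 ≤ pX x) (pX1 : mass pX = 1)
    (pXα : ∀ x, pX x ≤ ((2 : ℝ) ^ (2 * k))⁻¹)
    (q0 : ∀ y, 0 ≤ q y) (qβ : ∀ y, q y ≤ ((2 : ℝ) ^ (2 * k))⁻¹)
    (S : Finset (Fin (2 ^ d))) (hS : S.card = h)
    (hgood : ∀ y, q y ≠ 0 → ∀ i ∈ S,
      exc pX (fun x => Ext₂ x (Ext₁ y (natToBits d (i : ℕ)))) ≤ τ)
    (hbad : ∀ y, q y ≠ 0 →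
      δ < exc pX (fun x (i : S) => SR l b Ext₁ Ext₂ Ext₃ Extq Extw Ext x y i.1)) :
    mass q ≤ 2 ^ ((h + 1) * ℓ) * ((2 : ℝ) ^ k)⁻¹ := by
  obtain ⟨hlM, hMr, N1, N2, N3, -, -, -⟩ := nat_params hℓ hl hh hd hk
  have h2 : 2 ≤ h := by
    rw [hh]; calc 2 = 2 ^ 1 := rfl
      _ ≤ 2 ^ l := Nat.pow_le_pow_right (by norm_num) hl
  have hb : 0 < b := by
    rcases Nat.eq_zero_or_pos b with hb | hb
    · exfalso
      have hd0 : d = 0 := by rw [hb] at hd; omega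
      have := Finset.card_le_univ S
      rw [Fintype.card_fin, hS, hd0] at this
      omega
    · exact hb
  set e : Fin h ≃o S := S.orderIsoOfFin hS with hedef
  let v : ℕ → ℕ := fun i => if hi : i < h then ((e ⟨i, hi⟩ : Fin (2 ^ d)) : ℕ) else 0
  have hvi : ∀ i : Fin h, v i = ((e i : Fin (2 ^ d)) : ℕ) := by
    intro i
    simp [v, i.2]
  have hmain := row_bound Ext₁ Extq Extw Ext Ext₂ Ext₃ (τ := τ) ε0.le hh hd hb hlM hMr N1 N2 N3
    hq hw he h3 pX0 pX1 pXα q0 qβ v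
    (fun i hi => by rw [hvi ⟨i, hi⟩]; exact Fin.isLt _)
    (fun i j hij hj => by
      rw [hvi ⟨i, hij.trans hj⟩, hvi ⟨j, hj⟩]
      have : e ⟨i, hij.trans hj⟩ < e ⟨j, hj⟩ := e.lt_iff_lt.2 hij
      exact this)
    (fun y hy i hi => by
      rw [hvi ⟨i, hi⟩]
      exact hgood y hy _ (e ⟨i, hi⟩).2)
  have hlow : δ * mass q ≤ ∑ y, q y * exc pX (fun x (i : Fin h) =>
      ssrV Extq Extw Ext x (Ext₃ y (Ext₂ x (Ext₁ y (natToBits d (v i)))))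
        (blockVal d l b (v i)) (b - 1)) := by
    unfold mass
    rw [Finset.mul_sum]
    refine Finset.sum_le_sum fun y _ => ?_
    by_cases hy : q y = 0
    · simp [hy]
    · rw [mul_comm]
      refine mul_le_mul_of_nonneg_left ?_ (q0 y)
      refine (hbad y hy).le.trans (le_of_eq ?_)
      rw [← exc_equiv pX (fun x (i : S) => SR l b Ext₁ Ext₂ Ext₃ Extq Extw Ext x y i.1)
        (Equiv.arrowCongr e.symm.toEquiv (Equiv.refl _))]
      congr 1
      funext x i
      simp only [Equiv.arrowCongr_apply, Function.comp, Equiv.refl_apply]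
      rw [SR_eq, hvi]
      rfl
  have hfin := hlow.trans hmain
  have hm := mass_nonneg q0
  set A : ℝ := (2 : ℝ) ^ (ℓ * h) * (2 ^ (k + ℓ) * ((2 : ℝ) ^ (2 * k))⁻¹) with hA
  have hA0 : 0 ≤ A := by positivity
  have hAe : A = 2 ^ ((h + 1) * ℓ) * ((2 : ℝ) ^ k)⁻¹ := by
    rw [hA]
    field_simp
    ring
  rw [← hAe]
  have a1 := mul_le_mul_of_nonneg_right r1 hm
  have a2 := mul_le_mul_of_nonneg_right r2 hA0
  have : δ * mass q ≤ δ * A := by nlinarith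
  exact le_of_mul_le_mul_left this δ0

theorem core {n k ℓ l h b d : ℕ} {ε₂ η : ℝ} (hη : 0 < η) (hn : (n : ℝ) * η ≤ 1)
    (hℓ : 1 ≤ ℓ) (hl : 0 < l) (hh : h = 2 ^ l) (hd : d ≤ b * l)
    (hk : 2 * (b * h + 2) * (h ^ 2 + 12) * ℓ ≤ k)
    (hε₂ : ε₂ ≤ η ^ 16) (h1 : 1 ≤ η ^ 16 * 2 ^ ℓ)
    {Ext₁ : BitStr n → BitStr d → BitStr ℓ}
    {Ext₂ : BitStr n → BitStr ℓ → BitStr ℓ}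
    {Ext₃ : BitStr n → BitStr ℓ → BitStr (9 * k / 10)}
    {Extq : BitStr ((h ^ 2 + 12) * ℓ) → BitStr ℓ → BitStr ℓ}
    {Extw : BitStr n → BitStr ℓ → BitStr ℓ}
    {Ext : BitStr (9 * k / 10) → BitStr ℓ → BitStr ((h ^ 2 + 12) * ℓ)}
    (H1 : IsSeededExtractor Ext₁ (k : ℝ) (1 / 4))
    (H2 : IsStrongSeededExtractor Ext₂ (k : ℝ) ε₂)
    (H3 : IsStrongSeededExtractor Ext₃ (k : ℝ) ε₂)
    (Hq : IsStrongSeededExtractor Extq (10 * ℓ : ℕ) ε₂)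
    (Hw : IsStrongSeededExtractor Extw (10 * ℓ : ℕ) ε₂)
    (He : IsStrongSeededExtractor Ext (2 * ((h ^ 2 + 12) * ℓ) : ℕ) ε₂)
    {pX pY : BitStr n → ℝ} (hX : IsProb pX) (hY : IsProb pY)
    (kX : IsKSource pX (2 * k : ℝ)) (kY : IsKSource pY (2 * k : ℝ)) :
    1 - ((2 : ℝ) ^ ℓ)⁻¹ ≤
      mass (restr pY (fun y =>
                  ∃ T : Finset (Fin (2 ^ d)),
                    (2 / 3 : ℝ) * (2 ^ d : ℕ) ≤ (T.card : ℝ) ∧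
                    ∀ S ⊆ T, S.card = h →
                      exc pX (fun x (i : S) =>
                        SR l b Ext₁ Ext₂ Ext₃ Extq Extw Ext x y i.1) ≤ η ^ 2)) := by
  obtain ⟨hlM, hMr, N1, N2, N3, N4, hk64, N5⟩ := nat_params hℓ hl hh hd hk
  have h2 : 2 ≤ h := by
    rw [hh]; calc 2 = 2 ^ 1 := rfl
      _ ≤ 2 ^ l := Nat.pow_le_pow_right (by norm_num) hl
  have conv : (2 : ℝ) ^ (-(2 * k : ℝ)) = ((2 : ℝ) ^ (2 * k))⁻¹ := by
    rw [Real.rpow_neg (by norm_num)]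
    congr 1
    rw [← Real.rpow_natCast]; push_cast; rfl
  have pXα : ∀ x, pX x ≤ ((2 : ℝ) ^ (2 * k))⁻¹ := fun x => by rw [← conv]; exact kX x
  have pYα : ∀ x, pY x ≤ ((2 : ℝ) ^ (2 * k))⁻¹ := fun x => by rw [← conv]; exact kY x
  have hkn : 2 * k ≤ n := by
    have : (1 : ℝ) ≤ 2 ^ n * ((2 : ℝ) ^ (2 * k))⁻¹ := by
      rw [← hX.2, ← card_bitStr n]
      calc ∑ a, pX a ≤ ∑ _a : BitStr n, ((2 : ℝ) ^ (2 * k))⁻¹ :=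
            Finset.sum_le_sum fun x _ => pXα x
        _ = _ := by simp
    rw [← div_eq_mul_inv, one_le_div (by positivity)] at this
    exact (pow_le_pow_iff_right₀ (by norm_num)).1 this
  obtain ⟨τ12, hετ, τ0, ε0, δ0, r1, r2⟩ := real_params (n := n) (k := k) (h := h)
    (K := 2 * (b * (3 * h + 2)) + h) hη hn (by exact_mod_cast hkn) (by exact_mod_cast hk64)
    (by exact_mod_cast N5) (by exact_mod_cast h2) (by positivity) rfl rfl rfl
  set ε := η ^ 16 with hε
  set τ := η ^ 8 with hτ
  set δ := η ^ 2 with hδ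
  have gq : GoodExt Extq (2 ^ (11 * ℓ)) ε := by
    have := goodExt_of_strong Hq hε₂ h1
    rwa [show 10 * ℓ + ℓ = 11 * ℓ by ring] at this
  have gw : GoodExt Extw (2 ^ (11 * ℓ)) ε := by
    have := goodExt_of_strong Hw hε₂ h1
    rwa [show 10 * ℓ + ℓ = 11 * ℓ by ring] at this
  have ge := goodExt_of_strong He hε₂ h1
  have g3 := goodExt_of_strong H3 hε₂ h1
  have pX1 : mass pX = 1 := hX.2
  have pY1 : mass pY = 1 := hY.2
  -- bad seeds
  set Bs : Finset (BitStr ℓ) := univ.filter fun s => τ < exc pX (fun x => Ext₂ x s) with hBs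
  have hBcard : (Bs.card : ℝ) ≤ 2 ^ ℓ * τ := by
    have kX' : IsKSource pX (k : ℝ) := fun x => (kX x).trans (by
      apply Real.rpow_le_rpow_of_exponent_le (by norm_num)
      have : (0 : ℝ) ≤ k := by positivity
      linarith)
    have hs := strong_exc H2 hX kX'
    have : Bs.card * τ ≤ ∑ r, exc pX (fun u => Ext₂ u r) := by
      calc (Bs.card : ℝ) * τ = ∑ _r ∈ Bs, τ := by simp
        _ ≤ ∑ r ∈ Bs, exc pX (fun u => Ext₂ u r) :=
            Finset.sum_le_sum fun r hr => (Finset.mem_filter.1 hr).2.le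
        _ ≤ _ := Finset.sum_le_sum_of_subset_of_nonneg (Finset.subset_univ _)
            fun r _ _ => exc_nonneg _ _
    have h3 : (2 : ℝ) ^ ℓ * ε₂ ≤ 2 ^ ℓ * (τ * τ) := by
      rw [← hετ]; gcongr
    have : Bs.card * τ ≤ (2 ^ ℓ * τ) * τ := by linarith
    exact le_of_mul_le_mul_right this τ0
  have hE1 := bad_seed H1 hY.1 pYα τ12 Bs hBcard
  set E1 : BitStr n → Prop := fun y => ((univ.filter fun i : Fin (2 ^ d) =>
      Ext₁ y (natToBits d i) ∉ Bs).card : ℝ) < 2 / 3 * (2 ^ d : ℕ) with hE1d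
  let T : BitStr n → Finset (Fin (2 ^ d)) := fun y => univ.filter fun i : Fin (2 ^ d) =>
      Ext₁ y (natToBits d i) ∉ Bs
  let BadS : Finset (Fin (2 ^ d)) → BitStr n → Prop := fun S y => S ⊆ T y ∧
    δ < exc pX (fun x (i : S) => SR l b Ext₁ Ext₂ Ext₃ Extq Extw Ext x y i.1)
  set A : ℝ := 2 ^ ((h + 1) * ℓ) * ((2 : ℝ) ^ k)⁻¹ with hA
  have hper : ∀ S ∈ powersetCard h (univ : Finset (Fin (2 ^ d))),
      mass (restr pY (BadS S)) ≤ A := by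
    intro S hS
    have hS' := (Finset.mem_powersetCard.1 hS).2
    refine per_set Ext₁ Ext₂ Ext₃ Extq Extw Ext ε0 δ0 hℓ hl hh hd hk r1 r2 gq gw ge g3
      hX.1 pX1 pXα (restr_nonneg hY.1 _) (fun y => (restr_le hY.1 _ y).trans (pYα y)) S hS' ?_ ?_
    · intro y hy i hi
      have hm := (Finset.mem_filter.1 ((restr_ne hy).1.1 hi)).2
      simpa [hBs] using hm
    · intro y hy
      exact (restr_ne hy).1.2
  set G : BitStr n → Prop := fun y => ∃ T : Finset (Fin (2 ^ d)),
                    (2 / 3 : ℝ) * (2 ^ d : ℕ) ≤ (T.card : ℝ) ∧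
                    ∀ S ⊆ T, S.card = h →
                      exc pX (fun x (i : S) =>
                        SR l b Ext₁ Ext₂ Ext₃ Extq Extw Ext x y i.1) ≤ δ with hG
  have hcover : mass pY ≤ mass (restr pY G) + mass (restr pY E1) +
      ∑ S ∈ powersetCard h (univ : Finset (Fin (2 ^ d))), mass (restr pY (BadS S)) := by
    unfold mass
    rw [Finset.sum_comm, ← Finset.sum_add_distrib, ← Finset.sum_add_distrib]
    refine Finset.sum_le_sum fun y _ => ?_
    have n1 := restr_nonneg hY.1 G y
    have n2 := restr_nonneg hY.1 E1 y
    have n3 : 0 ≤ ∑ S ∈ powersetCard h (univ : Finset (Fin (2 ^ d))), restr pY (BadS S) y :=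
      Finset.sum_nonneg fun S _ => restr_nonneg hY.1 _ _
    by_cases c1 : G y
    · have : restr pY G y = pY y := by simp [restr, c1]
      linarith
    by_cases c2 : E1 y
    · have : restr pY E1 y = pY y := by simp [restr, c2]
      linarith
    have : ∃ S ∈ powersetCard h (univ : Finset (Fin (2 ^ d))), BadS S y := by
      by_contra hcon
      push Not at hcon
      apply c1
      refine ⟨T y, not_lt.1 c2, fun S hST hSc => ?_⟩
      by_contra hlt
      exact hcon S (Finset.mem_powersetCard.2 ⟨Finset.subset_univ _, hSc⟩)
        ⟨hST, not_le.1 hlt⟩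
    obtain ⟨S, hS, hSb⟩ := this
    have h5 : restr pY (BadS S) y = pY y := by simp [restr, hSb]
    have h6 := Finset.single_le_sum (f := fun S => restr pY (BadS S) y)
      (fun S _ => restr_nonneg hY.1 _ _) hS
    simp only [h5] at h6
    linarith
  have hsum : ∑ S ∈ powersetCard h (univ : Finset (Fin (2 ^ d))), mass (restr pY (BadS S)) ≤
      2 ^ (d * h) * A := by
    refine (Finset.sum_le_card_nsmul _ _ A hper).trans ?_
    rw [nsmul_eq_mul]
    apply mul_le_mul_of_nonneg_right _ (by positivity)
    rw [Finset.card_powersetCard, Finset.card_univ, Fintype.card_fin]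
    have : (2 ^ d).choose h ≤ (2 ^ d) ^ h := Nat.choose_le_pow _ _
    rw [← pow_mul] at this
    exact_mod_cast this
  have hA2 : 2 ^ (d * h) * A ≤ ((2 : ℝ) ^ (ℓ + 1))⁻¹ := by
    rw [hA, ← mul_assoc, ← pow_add, ← div_eq_mul_inv, div_le_iff₀ (by positivity),
      inv_mul_eq_div, le_div_iff₀ (by positivity), ← pow_add]
    exact pow_le_pow_right₀ (by norm_num) (by omega)
  have hE2 : ((2 : ℝ) ^ k)⁻¹ ≤ ((2 : ℝ) ^ (ℓ + 1))⁻¹ :=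
    inv_anti₀ (by positivity) (pow_le_pow_right₀ (by norm_num) (by omega))
  have hhalf : ((2 : ℝ) ^ (ℓ + 1))⁻¹ + ((2 : ℝ) ^ (ℓ + 1))⁻¹ = ((2 : ℝ) ^ ℓ)⁻¹ := by
    rw [pow_succ]; field_simp; norm_num
  rw [pY1] at hcover
  linarith

end Core

/-- Lemma 4.5 of the paper. For every `γ > 0` there are constants
`C > 1` and `c > 0` such that, under the parameter constraints of Algorithm SR
(`ε₂ ≤ 2^{−γℓ}`, `k ≥ 2(bh+2)(h²+12)ℓ`, `k ≥ (h+1)ℓ`, `ℓ ≥ C·h·log₂ n`), for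
independent `(n,2k)`-sources `X, Y` and `Z = SR(X, Y)`: with probability at least
`1 − 2^{−cℓ}` over `y ← Y` there is `T ⊆ [N]`, `|T| ≥ (2/3)N`, such that every `h`
rows of `Z` indexed within `T` are (conditioned on `Y = y`) `2^{−cℓ}`-close to
uniform. -/
theorem sr_h_wise_independent :
    ∀ γ : ℝ, 0 < γ →
      ∃ C c : ℝ, 1 < C ∧ 0 < c ∧
        ∀ (n k ℓ l h b d : ℕ) (α β ε₂ : ℝ),
          0 < α → α < β → β < 1 →
          ℓ = ⌈(k : ℝ) ^ β⌉₊ →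
          0 < l → h = 2 ^ l →
          (k : ℝ) ^ α ≤ (h : ℝ) → (h : ℝ) < 2 * (k : ℝ) ^ α →
          b = ⌈(d : ℝ) / (l : ℝ)⌉₊ →
          ε₂ ≤ (2 : ℝ) ^ (-(γ * ℓ)) →
          2 * (b * h + 2) * (h ^ 2 + 12) * ℓ ≤ k →
          (h + 1) * ℓ ≤ k →
          C * h * Real.logb 2 n ≤ (ℓ : ℝ) →
          ∀ (Ext₁ : BitStr n → BitStr d → BitStr ℓ)
            (Ext₂ : BitStr n → BitStr ℓ → BitStr ℓ)
            (Ext₃ : BitStr n → BitStr ℓ → BitStr (9 * k / 10))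
            (Extq : BitStr ((h ^ 2 + 12) * ℓ) → BitStr ℓ → BitStr ℓ)
            (Extw : BitStr n → BitStr ℓ → BitStr ℓ)
            (Ext : BitStr (9 * k / 10) → BitStr ℓ → BitStr ((h ^ 2 + 12) * ℓ)),
            IsSeededExtractor Ext₁ (k : ℝ) (1 / 4) →
            IsStrongSeededExtractor Ext₂ (k : ℝ) ε₂ →
            IsStrongSeededExtractor Ext₃ (k : ℝ) ε₂ →
            IsStrongSeededExtractor Extq (10 * ℓ : ℕ) ε₂ →
            IsStrongSeededExtractor Extw (10 * ℓ : ℕ) ε₂ →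
            IsStrongSeededExtractor Ext (2 * ((h ^ 2 + 12) * ℓ) : ℕ) ε₂ →
            ∀ pX pY : BitStr n → ℝ,
              IsProb pX → IsProb pY →
              IsKSource pX (2 * k : ℝ) → IsKSource pY (2 * k : ℝ) →
              1 - (2 : ℝ) ^ (-(c * ℓ)) ≤
                probOf pY (fun y =>
                  ∃ T : Finset (Fin (2 ^ d)),
                    (2 / 3 : ℝ) * (2 ^ d : ℕ) ≤ (T.card : ℝ) ∧
                    ∀ S ⊆ T, S.card = h →
                      statDist
                        (fun zs : ↥S → BitStr ℓ =>
                          ∑ x : BitStr n,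
                            if ∀ i : ↥S,
                                SR l b Ext₁ Ext₂ Ext₃ Extq Extw Ext x y i.1 = zs i
                            then pX x else 0)
                        (unif (↥S → BitStr ℓ)) ≤ (2 : ℝ) ^ (-(c * ℓ))) := by
  intro γ hγ
  obtain ⟨g, hg⟩ : ∃ g : ℝ, g = min γ 1 := ⟨_, rfl⟩
  have g0 : 0 < g := by rw [hg]; exact lt_min hγ one_pos
  have g1 : g ≤ 1 := by rw [hg]; exact min_le_right _ _
  have gγ : g ≤ γ := by rw [hg]; exact min_le_left _ _
  refine ⟨8 / g, g / 8, ?_, by positivity, ?_⟩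
  · rw [lt_div_iff₀ g0]; linarith
  intro n k ℓ l h b d α β ε₂ hα hαβ hβ hℓ hl hh hka hkb hb hε₂ hk _ hC Ext₁ Ext₂ Ext₃ Extq Extw
    Ext H1 H2 H3 Hq Hw He pX pY hX hY kX kY
  have h2 : 2 ≤ h := by
    rw [hh]; calc 2 = 2 ^ 1 := rfl
      _ ≤ 2 ^ l := Nat.pow_le_pow_right (by norm_num) hl
  have h2R : (2 : ℝ) ≤ h := by exact_mod_cast h2
  have k0 : k ≠ 0 := by
    rintro rfl
    rw [Nat.cast_zero, Real.zero_rpow hα.ne'] at hkb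
    linarith
  have hℓ1 : 1 ≤ ℓ := by
    rw [hℓ, Nat.one_le_ceil_iff]
    have : (0 : ℝ) < k := by exact_mod_cast Nat.pos_of_ne_zero k0
    positivity
  have hd : d ≤ b * l := by
    have : (d : ℝ) / l ≤ b := by rw [hb]; exact Nat.le_ceil _
    rw [div_le_iff₀ (by exact_mod_cast hl)] at this
    exact_mod_cast this
  obtain ⟨η, hη⟩ : ∃ η : ℝ, η = (2 : ℝ) ^ (-(g * ℓ / 16)) := ⟨_, rfl⟩
  have η0 : 0 < η := by rw [hη]; positivity
  have ηp : ∀ m : ℕ, η ^ m = (2 : ℝ) ^ (-(g * ℓ / 16) * m) := by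
    intro m
    rw [hη, ← Real.rpow_natCast, ← Real.rpow_mul (by norm_num)]
  have ηδ : η ^ 2 = (2 : ℝ) ^ (-(g / 8 * ℓ)) := by
    rw [ηp]; congr 1; push_cast; ring
  have ηε : η ^ 16 = (2 : ℝ) ^ (-(g * ℓ)) := by
    rw [ηp]; congr 1; push_cast; ring
  have ℓ0 : (0 : ℝ) ≤ ℓ := by positivity
  have hnη : (n : ℝ) * η ≤ 1 := by
    rcases Nat.eq_zero_or_pos n with hn | hn
    · simp [hn]
    have nR : (1 : ℝ) ≤ n := by exact_mod_cast hn
    have n0 : (0 : ℝ) < n := by linarith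
    have lg0 : 0 ≤ Real.logb 2 n := Real.logb_nonneg (by norm_num) nR
    have hlog : Real.logb 2 n ≤ g * ℓ / 16 := by
      have a1 : 8 / g * 2 * Real.logb 2 n ≤ 8 / g * h * Real.logb 2 n := by gcongr
      have a2 := a1.trans hC
      have a3 : 8 / g * 2 * Real.logb 2 n = 16 * Real.logb 2 n / g := by ring
      rw [a3, div_le_iff₀ g0] at a2
      linarith
    have : (n : ℝ) ≤ (2 : ℝ) ^ (g * ℓ / 16) :=
      (Real.logb_le_iff_le_rpow (by norm_num) n0).1 hlog
    rw [hη, Real.rpow_neg (by norm_num), ← div_eq_mul_inv, div_le_one (by positivity)]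
    exact this
  have hε' : ε₂ ≤ η ^ 16 := by
    refine hε₂.trans ?_
    rw [ηε]
    apply Real.rpow_le_rpow_of_exponent_le (by norm_num)
    have := mul_le_mul_of_nonneg_right gγ ℓ0
    linarith
  have h1 : 1 ≤ η ^ 16 * 2 ^ ℓ := by
    rw [ηε, ← Real.rpow_natCast, ← Real.rpow_add (by norm_num)]
    apply Real.one_le_rpow (by norm_num)
    have := mul_le_mul_of_nonneg_right g1 ℓ0
    linarith
  have hmain := core η0 hnη hℓ1 hl hh hd hk hε' h1 H1 H2 H3 Hq Hw He hX hY kX kY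
  have hδ : ((2 : ℝ) ^ ℓ)⁻¹ ≤ (2 : ℝ) ^ (-(g / 8 * ℓ)) := by
    rw [← Real.rpow_natCast, ← Real.rpow_neg (by norm_num)]
    apply Real.rpow_le_rpow_of_exponent_le (by norm_num)
    have := mul_le_mul_of_nonneg_right g1 ℓ0
    linarith
  refine le_trans (by linarith) (hmain.trans ?_)
  unfold mass restr probOf
  refine Finset.sum_le_sum fun y _ => ?_
  split_ifs with c1 c2 c2
  · exact le_rfl
  · exfalso
    apply c2
    obtain ⟨T, hT, hTS⟩ := c1
    refine ⟨T, hT, fun S hS hSc => ?_⟩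
    rw [← ηδ]
    refine le_trans ?_ (hTS S hS hSc)
    refine statDist_le_exc (p := pX) hX.2
      (fun x (i : S) => SR l b Ext₁ Ext₂ Ext₃ Extq Extw Ext x y i.1)
  · exact hY.1 y
  · exact le_rfl
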